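/- arXiv:2411.17322 — 3 statements merged into one kernel-verified Lean document; each statement's English description precedes it below -/
import Mathlib

section
/- Let k ≥ 4 be even, set t = ⌊(k-1)/2⌋ = (k-2)/2, and let F be a 2-connected graph with p(F) ≥ t+1. Then there exist constants C = C(k,F) and N = N(k,F) such that for all n ≥ N, | ex(n, {𝓒_{≥k}, F}) − n·max{ (k-2)/2 , ex(k-1,F)/(k-2) } | ≤ C. -/
open SimpleGraph

section Defs

variable {V α β : Type*}

/-- `G` contains a copy of `F` as a (not necessarily induced) subgraph. -/
def ContainsCopy (F : SimpleGraph α) (G : SimpleGraph β) : Prop :=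
  ∃ f : α → β, Function.Injective f ∧ ∀ ⦃a b⦄, F.Adj a b → G.Adj (f a) (f b)

/-- The number of edges of `G`. -/
noncomputable def edgeCount (G : SimpleGraph V) : ℕ := G.edgeSet.ncard

/-- `G` has a cycle of length at least `k`, i.e. `G` is not `𝓒_{≥k}`-free. -/
def HasCycleGE (G : SimpleGraph V) (k : ℕ) : Prop :=
  ∃ (v : V) (w : G.Walk v v), w.IsCycle ∧ k ≤ w.length

/-- `G` is 2-connected: it has at least 3 vertices, is connected, and stays
connected after deleting any single vertex. -/
def TwoConnected [Fintype V] (G : SimpleGraph V) : Prop :=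
  3 ≤ Fintype.card V ∧ G.Connected ∧ ∀ v : V, (G.induce ({v}ᶜ : Set V)).Connected

/-- `p(F) ≥ s`: for every proper 2-coloring of `F` both color classes have size
at least `s` (vacuously true for nonbipartite `F`, where `p(F) = ∞`). -/
def PGE [Fintype α] (F : SimpleGraph α) (s : ℕ) : Prop :=
  ∀ c : α → Bool, (∀ a b, F.Adj a b → c a ≠ c b) →
    s ≤ {a | c a = true}.ncard ∧ s ≤ {a | c a = false}.ncard

/-- `S` is a vertex covering of `F`: the complement of `S` is independent. -/
def IsVertexCovering (F : SimpleGraph α) (S : Set α) : Prop :=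
  ∀ a b, a ∉ S → b ∉ S → ¬ F.Adj a b

/-- `G` is `𝓗`-free, where `𝓗 = {F[S] : S is a vertex covering of F}`. -/
def CoverFree (F : SimpleGraph α) (G : SimpleGraph β) : Prop :=
  ∀ S : Set α, IsVertexCovering F S → ¬ ContainsCopy (F.induce S) G

/-- The maximum number of edges of an `n`-vertex graph satisfying `P`
(a generic Turán-type extremal number). -/
noncomputable def exMax (n : ℕ) (P : SimpleGraph (Fin n) → Prop) : ℕ :=
  sSup {m | ∃ G : SimpleGraph (Fin n), P G ∧ edgeCount G = m}

/-- The number of edges of `G` with both endpoints in `T`, i.e. `e(G[T])`. -/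
noncomputable def edgesWithin (G : SimpleGraph V) (T : Set V) : ℕ :=
  {e ∈ G.edgeSet | ∀ x ∈ e, x ∈ T}.ncard

/-- The number of edges of `G` with both endpoints outside `T`, i.e. `e(G−T)`. -/
noncomputable def edgesOutside (G : SimpleGraph V) (T : Set V) : ℕ :=
  {e ∈ G.edgeSet | ∀ x ∈ e, x ∉ T}.ncard

/-- The number of edges of `G` with exactly one endpoint in `T`, i.e. `e(G−T, T)`. -/
noncomputable def edgesCross (G : SimpleGraph V) (T : Set V) : ℕ :=
  {e ∈ G.edgeSet | ∃ a b, e = s(a, b) ∧ a ∈ T ∧ b ∉ T}.ncard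

/-- The number of neighbors of `u` lying in `T` (e.g. `d_C(u)` for `T = V(C)`). -/
noncomputable def degOn (G : SimpleGraph V) (T : Set V) (u : V) : ℕ :=
  {x ∈ T | G.Adj u x}.ncard

/-- The join `T ∨ I_b` of a graph `T` on `Fin a` with an independent set of
`b` vertices. -/
def joinIndep (a b : ℕ) (T : SimpleGraph (Fin a)) : SimpleGraph (Fin a ⊕ Fin b) :=
  SimpleGraph.fromRel (fun x y =>
    x.isLeft ≠ y.isLeft ∨ ∃ u v, x = Sum.inl u ∧ y = Sum.inl v ∧ T.Adj u v)

end Defs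

set_option linter.unusedSectionVars false

section Aux
variable {V : Type*} [DecidableEq V] {G : SimpleGraph V}

/-- There is a path from `x` to `y` with vertex set `S`. -/
def Pth (G : SimpleGraph V) (x y : V) (S : Finset V) : Prop :=
  ∃ w : G.Walk x y, w.IsPath ∧ ∀ v, v ∈ S ↔ v ∈ w.support

lemma Pth.nil (x : V) : Pth G x x {x} := ⟨Walk.nil, by simp, by simp⟩

lemma Pth.symm {x y : V} {S : Finset V} (h : Pth G x y S) : Pth G y x S := by
  obtain ⟨w, hw, hS⟩ := h
  exact ⟨w.reverse, hw.reverse, by simpa using hS⟩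

lemma Pth.left_mem {x y : V} {S : Finset V} (h : Pth G x y S) : x ∈ S := by
  obtain ⟨w, hw, hS⟩ := h
  simp [hS]

lemma Pth.right_mem {x y : V} {S : Finset V} (h : Pth G x y S) : y ∈ S := by
  obtain ⟨w, hw, hS⟩ := h
  simp [hS]

lemma Pth.catAdj {x y y' z : V} {S T : Finset V} (h : Pth G x y S) (ha : G.Adj y y')
    (h' : Pth G y' z T) (hd : ∀ v, v ∈ S → v ∈ T → False) : Pth G x z (S ∪ T) := by
  obtain ⟨w, hw, hS⟩ := h
  obtain ⟨w', hw', hT⟩ := h'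
  refine ⟨w.append (Walk.cons ha w'), ?_, ?_⟩
  · rw [Walk.isPath_def, Walk.support_append, Walk.support_cons, List.tail_cons, List.nodup_append]
    refine ⟨hw.support_nodup, hw'.support_nodup, ?_⟩
    rintro a h1 b h2 rfl
    exact hd a ((hS a).2 h1) ((hT a).2 h2)
  · intro v
    simp [hS, hT, Walk.support_append]

lemma Pth.cat {x y z : V} {S T : Finset V} (h : Pth G x y S)
    (h' : Pth G y z T) (hd : ∀ v, v ∈ S → v ∈ T → v = y) : Pth G x z (S ∪ T) := by
  obtain ⟨w, hw, hS⟩ := h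
  obtain ⟨w', hw', hT⟩ := h'
  refine ⟨w.append w', ?_, ?_⟩
  · rw [Walk.isPath_def, Walk.support_append, List.nodup_append]
    refine ⟨hw.support_nodup, hw'.support_nodup.tail, ?_⟩
    rintro a h1 b h2 rfl
    have h3 := hd a ((hS a).2 h1) ((hT a).2 (List.mem_of_mem_tail h2))
    subst h3
    have := hw'.support_nodup
    rw [← Walk.cons_tail_support] at this
    exact (List.nodup_cons.1 this).1 h2
  · intro v
    rw [Walk.mem_support_append_iff, Finset.mem_union, hS, hT]

lemma Pth.split {x y u : V} {S : Finset V} (h : Pth G x y S) (hu : u ∈ S) :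
    ∃ A B, Pth G x u A ∧ Pth G u y B ∧ A ∪ B = S ∧ ∀ v, v ∈ A → v ∈ B → v = u := by
  obtain ⟨w, hw, hS⟩ := h
  have hu' := (hS u).1 hu
  refine ⟨(w.takeUntil u hu').support.toFinset, (w.dropUntil u hu').support.toFinset,
    ⟨w.takeUntil u hu', hw.takeUntil hu', by simp⟩, ⟨w.dropUntil u hu', hw.dropUntil hu', by simp⟩, ?_, ?_⟩
  · ext v
    rw [hS, Finset.mem_union, List.mem_toFinset, List.mem_toFinset, ← Walk.mem_support_append_iff,
      Walk.take_spec]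
  · intro v h1 h2
    rw [List.mem_toFinset] at h1 h2
    by_contra hne
    have h3 : v ∈ (w.dropUntil u hu').support.tail := by
      rw [← Walk.cons_tail_support, List.mem_cons] at h2
      exact h2.resolve_left hne
    have := hw.support_nodup
    rw [← Walk.take_spec w hu', Walk.support_append, List.nodup_append] at this
    exact this.2.2 v h1 v h3 rfl

lemma Pth.pred {x y : V} {S : Finset V} (h : Pth G x y S) (hne : x ≠ y) :
    ∃ y', Pth G x y' (S.erase y) ∧ G.Adj y' y := by
  obtain ⟨w, hw, hS⟩ := h.symm
  cases w with
  | nil => exact absurd rfl hne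
  | @cons _ z _ ha w =>
    rw [Walk.cons_isPath_iff] at hw
    refine ⟨z, Pth.symm ⟨w, hw.1, ?_⟩, ha.symm⟩
    intro v
    simp only [Finset.mem_erase, hS, Walk.support_cons, List.mem_cons]
    have := hw.2
    constructor
    · tauto
    · intro hv
      exact ⟨by rintro rfl; exact this hv, Or.inr hv⟩

lemma Pth.card {x y : V} {S : Finset V} {w : G.Walk x y} (hw : w.IsPath)
    (hS : ∀ v, v ∈ S ↔ v ∈ w.support) : S.card = w.length + 1 := by
  have : S = w.support.toFinset := by ext v; simp [hS]
  rw [this, List.toFinset_card_of_nodup hw.support_nodup, Walk.length_support]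

lemma Pth.cycle {x y : V} {S : Finset V} (h : Pth G x y S) (ha : G.Adj y x) (h3 : 3 ≤ S.card) :
    ∃ (v : V) (w : G.Walk v v), w.IsCycle ∧ w.length = S.card := by
  obtain ⟨w, hw, hS⟩ := h
  have hc := Pth.card hw hS
  refine ⟨y, Walk.cons ha w, ?_, by simp [hc]⟩
  rw [Walk.cons_isCycle_iff]
  refine ⟨hw, ?_⟩
  intro he
  cases w with
  | nil => simp at he
  | @cons _ z _ hb w =>
    rw [Walk.cons_isPath_iff] at hw
    rw [Walk.edges_cons, List.mem_cons] at he
    rcases he with he | he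
    · have hz : z = y := by
        rw [Sym2.eq_iff] at he
        rcases he with ⟨h1, h2⟩ | ⟨h1, h2⟩
        · exact absurd h1.symm (by rintro rfl; exact G.loopless.irrefl _ ha)
        · exact h1.symm
      subst hz
      have := hw.1
      rw [Walk.isPath_iff_nil] at this
      have h0 := Walk.length_eq_zero_iff.2 this
      rw [Walk.length_cons, h0] at hc
      omega
    · exact hw.2 (w.snd_mem_support_of_mem_edges he)

lemma Pth.seg {p : ℕ → V} {m : ℕ} (hinj : ∀ i j, i ≤ m → j ≤ m → p i = p j → i = j)
    (hadj : ∀ i, i < m → G.Adj (p i) (p (i+1))) (i j : ℕ) (hij : i ≤ j) (hj : j ≤ m) :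
    Pth G (p i) (p j) ((Finset.Icc i j).image p) := by
  induction j, hij using Nat.le_induction with
  | base => simpa using Pth.nil (p i)
  | succ j hij ih =>
    have := (ih (by omega)).catAdj (hadj j (by omega)) (Pth.nil _) (by
      intro v hv hv'
      simp only [Finset.mem_image, Finset.mem_Icc, Finset.mem_singleton] at hv hv'
      obtain ⟨l, hl, rfl⟩ := hv
      have := hinj _ _ (by omega) hj hv'
      omega)
    convert this using 1
    ext v
    simp only [Finset.mem_image, Finset.mem_Icc, Finset.mem_singleton, Finset.mem_union]
    constructor
    · rintro ⟨l, hl, rfl⟩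
      by_cases h : l = j + 1
      · right; rw [h]
      · left; exact ⟨l, by omega, rfl⟩
    · rintro (⟨l, hl, rfl⟩ | rfl)
      · exact ⟨l, by omega, rfl⟩
      · exact ⟨j+1, by omega, rfl⟩

/-- relative 2-connectivity -/
def TC (G : SimpleGraph V) (S : Finset V) : Prop :=
  ∀ A B : Finset V, A ∪ B = S → A ≠ S → B ≠ S → (A ∩ B).card ≤ 1 →
    ∃ a b, a ∈ A ∧ a ∉ B ∧ b ∈ B ∧ b ∉ A ∧ G.Adj a b

lemma TC.bridge {S : Finset V} (h : TC G S) {c : V} (hc : c ∈ S) {X Y : Finset V}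
    (hX : X ⊆ S) (hY : Y ⊆ S) (hcX : c ∉ X) (hcY : c ∉ Y) (hXn : X.Nonempty) (hYn : Y.Nonempty)
    (hXY : ∀ v, v ∈ X → v ∈ Y → False) :
    ∃ u v R, u ∈ X ∧ v ∈ Y ∧ Pth G u v R ∧ R ⊆ S ∧ c ∉ R ∧ (∀ z ∈ R, z ∈ X → z = u) ∧
      (∀ z ∈ R, z ∈ Y → z = v) := by
  classical
  by_contra hcon
  push Not at hcon
  set Z := S.filter (fun z => ∃ u ∈ X, ∃ R, Pth G u z R ∧ R ⊆ S ∧ c ∉ R ∧ (∀ z ∈ R, z ∈ X → z = u) ∧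
      (∀ z ∈ R, z ∉ Y)) with hZ
  have hXZ : X ⊆ Z := by
    intro x hx
    rw [hZ, Finset.mem_filter]
    refine ⟨hX hx, x, hx, {x}, Pth.nil x, by simpa using hX hx, ?_, by simp, ?_⟩
    · simp; rintro rfl; exact hcX hx
    · intro z hz; simp at hz; subst hz; exact fun h => hXY _ hx h
  have hcZ : c ∉ Z := by
    intro hcz
    obtain ⟨_, u, hu, R, hR, _, h1, _⟩ := Finset.mem_filter.1 hcz
    exact h1 hR.right_mem
  have hYZ : ∀ y ∈ Y, y ∉ Z := by
    intro y hy hcz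
    obtain ⟨_, u, hu, R, hR, _, h1, _, h2⟩ := Finset.mem_filter.1 hcz
    exact h2 _ hR.right_mem hy
  have hZS : Z ⊆ S := Finset.filter_subset _ _
  obtain ⟨a, b, ha, ha', hb, hb', hab⟩ := h (insert c Z) (S \ Z) (by
      ext v; simp only [Finset.mem_union, Finset.mem_insert, Finset.mem_sdiff]
      constructor
      · rintro ((rfl | h) | h)
        exacts [hc, hZS h, h.1]
      · tauto)
    (by
      obtain ⟨y, hy⟩ := hYn
      intro he
      have := hY hy
      rw [← he, Finset.mem_insert] at this
      rcases this with rfl | h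
      exacts [hcY hy, hYZ y hy h])
    (by
      obtain ⟨x, hx⟩ := hXn
      intro he
      have := hX hx
      rw [← he, Finset.mem_sdiff] at this
      exact this.2 (hXZ hx))
    (by
      rw [Finset.card_le_one]
      intro u hu v hv
      simp only [Finset.mem_inter, Finset.mem_insert, Finset.mem_sdiff] at hu hv
      grind)
  have haZ : a ∈ Z := by
    by_contra hn
    simp only [Finset.mem_insert] at ha
    rcases ha with rfl | ha
    · exact ha' (Finset.mem_sdiff.2 ⟨hc, hn⟩)
    · exact hn ha
  obtain ⟨hbS, hbZ⟩ := Finset.mem_sdiff.1 hb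
  have hbc : b ≠ c := by rintro rfl; exact hb' (Finset.mem_insert_self _ _)
  obtain ⟨haS, u, hu, R, hR, hRS, hcR, hRX, hRY⟩ := Finset.mem_filter.1 haZ
  by_cases hbR : b ∈ R
  · obtain ⟨R1, R2, hR1, hR2, hRU, hRI⟩ := hR.split hbR
    apply hbZ
    have hsub : R1 ⊆ R := by rw [← hRU]; exact Finset.subset_union_left
    rw [hZ, Finset.mem_filter]
    exact ⟨hbS, u, hu, R1, hR1, hsub.trans hRS, fun h => hcR (hsub h), fun z hz => hRX z (hsub hz),
      fun z hz => hRY z (hsub hz)⟩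
  have hbX : b ∉ X := fun h => hbZ (hXZ h)
  have hnew : Pth G u b (R ∪ {b}) := hR.catAdj hab (Pth.nil b) (by
    intro v hv hv'; rw [Finset.mem_singleton] at hv'; subst hv'; exact hbR hv)
  by_cases hbY : b ∈ Y
  · obtain ⟨z, hz, hzY, hzb⟩ := hcon u b (R ∪ {b}) hu hbY hnew (by
      intro v hv; rw [Finset.mem_union, Finset.mem_singleton] at hv
      rcases hv with hv | rfl
      exacts [hRS hv, hbS]) (by
      simp only [Finset.mem_union, Finset.mem_singleton]; rintro (h | h)
      exacts [hcR h, hbc h.symm]) (by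
      intro z hz hzX
      simp only [Finset.mem_union, Finset.mem_singleton] at hz
      rcases hz with hz | rfl
      exacts [hRX z hz hzX, absurd hzX hbX])
    simp only [Finset.mem_union, Finset.mem_singleton] at hz
    rcases hz with hz | hz
    exacts [hRY z hz hzY, hzb hz]
  · apply hbZ
    rw [hZ, Finset.mem_filter]
    refine ⟨hbS, u, hu, _, hnew, ?_, ?_, ?_, ?_⟩
    · intro v hv; rw [Finset.mem_union, Finset.mem_singleton] at hv
      rcases hv with hv | rfl
      exacts [hRS hv, hbS]
    · simp only [Finset.mem_union, Finset.mem_singleton]; rintro (h | h)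
      exacts [hcR h, hbc h.symm]
    · intro z hz hzX
      simp only [Finset.mem_union, Finset.mem_singleton] at hz
      rcases hz with hz | rfl
      exacts [hRX z hz hzX, absurd hzX hbX]
    · intro z hz
      simp only [Finset.mem_union, Finset.mem_singleton] at hz
      rcases hz with hz | rfl
      exacts [hRY z hz, hbY]

end Aux

section Vine
variable {V : Type*} [DecidableEq V] {G : SimpleGraph V}

lemma vine_step {S : Finset V} (h : TC G S) {p : ℕ → V} {m : ℕ}
    (hinj : ∀ i j, i ≤ m → j ≤ m → p i = p j → i = j)
    (hpS : ∀ i, i ≤ m → p i ∈ S)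
    {a c i : ℕ} (ha : 0 < a) (hac : a ≤ c) (hcm : c < m)
    {S1 S2 : Finset V} (h1 : Pth G (p a) (p c) S1)
    (h2 : (c = a ∧ S1 = {p a} ∧ S2 = {p a}) ∨ (i < a ∧ Pth G (p c) (p i) S2))
    (hI : ∀ v, v ∈ S1 → v ∈ S2 → v = p c) (hS1 : S1 ⊆ S) (hS2 : S2 ⊆ S)
    (h1a : ∀ l, l < a → p l ∉ S1) (h2a : ∀ l, l < a → p l ∈ S2 → l = i)
    (h1c : ∀ l, c < l → l ≤ m → p l ∉ S1) (h2c : ∀ l, c < l → l ≤ m → p l ∉ S2) :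
    ∃ r i', c < r ∧ r ≤ m ∧ i' < a ∧ ∀ D, Pth G (p c) (p r) D → (∀ v ∈ D, ∃ l, c ≤ l ∧ l ≤ m ∧ v = p l) →
      ∃ S1' S2', Pth G (p a) (p r) S1' ∧ Pth G (p r) (p i') S2' ∧
        (∀ v, v ∈ S1' → v ∈ S2' → v = p r) ∧ S1' ⊆ S ∧ S2' ⊆ S ∧ D ⊆ S1' ∪ S2' ∧
        (∀ l, l < a → p l ∉ S1') ∧ (∀ l, l < a → p l ∈ S2' → l = i') ∧
        (∀ l, c < l → l ≤ m → p l ∈ S1' ∪ S2' → p l ∈ D) := by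
  obtain ⟨u, v, R, hu, hv, hR, hRS, hcR, hRX, hRY⟩ := h.bridge (hpS c hcm.le)
    (X := (S1 ∪ S2 ∪ (Finset.range a).image p).erase (p c)) (Y := (Finset.Ioc c m).image p)
    (by
      intro v hv
      simp only [Finset.mem_erase, Finset.mem_union, Finset.mem_image, Finset.mem_range] at hv
      rcases hv with ⟨_, (hv | hv) | ⟨l, hl, rfl⟩⟩
      exacts [hS1 hv, hS2 hv, hpS l (by omega)])
    (by
      intro v hv
      simp only [Finset.mem_image, Finset.mem_Ioc] at hv
      obtain ⟨l, hl, rfl⟩ := hv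
      exact hpS l hl.2)
    (by simp)
    (by
      simp only [Finset.mem_image, Finset.mem_Ioc, not_exists, not_and]
      intro l hl he
      have := hinj _ _ hl.2 hcm.le he
      omega)
    ⟨p 0, by
      simp only [Finset.mem_erase, Finset.mem_union, Finset.mem_image, Finset.mem_range]
      refine ⟨fun he => ?_, Or.inr ⟨0, ha, rfl⟩⟩
      have := hinj _ _ (by omega) hcm.le he
      omega⟩
    ⟨p m, Finset.mem_image_of_mem _ (by simp; omega)⟩
    (by
      intro v hv hv'
      simp only [Finset.mem_erase, Finset.mem_union, Finset.mem_image, Finset.mem_range,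
        Finset.mem_Ioc] at hv hv'
      obtain ⟨l, hl, rfl⟩ := hv'
      rcases hv with ⟨_, (hv | hv) | ⟨l', hl', he⟩⟩
      · exact h1c l hl.1 hl.2 hv
      · exact h2c l hl.1 hl.2 hv
      · have := hinj _ _ (by omega) (by omega) he
        omega)
  simp only [Finset.mem_image, Finset.mem_Ioc] at hv
  obtain ⟨r, ⟨hcr, hrm⟩, rfl⟩ := hv
  -- facts about R
  have hR1 : ∀ v ∈ R, v ∈ S1 → v = u := fun v hv hv' => hRX v hv (by
    rw [Finset.mem_erase, Finset.mem_union, Finset.mem_union]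
    exact ⟨by rintro rfl; exact hcR hv, Or.inl (Or.inl hv')⟩)
  have hR2 : ∀ v ∈ R, v ∈ S2 → v = u := fun v hv hv' => hRX v hv (by
    rw [Finset.mem_erase, Finset.mem_union, Finset.mem_union]
    exact ⟨by rintro rfl; exact hcR hv, Or.inl (Or.inr hv')⟩)
  have hRa : ∀ l, l < a → p l ∈ R → p l = u := fun l hl hv => hRX _ hv (by
    rw [Finset.mem_erase, Finset.mem_union, Finset.mem_union]
    exact ⟨fun he => hcR (he ▸ hv), Or.inr (Finset.mem_image_of_mem _ (by simpa using hl))⟩)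
  have hRc : ∀ l, c < l → l ≤ m → p l ∈ R → l = r := fun l hl hlm hv =>
    hinj _ _ hlm hrm (hRY _ hv (Finset.mem_image_of_mem _ (by simp; omega)))
  have huc : u ≠ p c := (Finset.mem_erase.1 hu).1
  have hu' := (Finset.mem_erase.1 hu).2
  have hprR := hR.right_mem
  -- facts about D
  have hD1 : ∀ D : Finset V, (∀ v ∈ D, ∃ l, c ≤ l ∧ l ≤ m ∧ v = p l) → ∀ v ∈ D, v ∈ S1 → v = p c := by
    intro D hD v hv hv1
    obtain ⟨l, hl, hlm, rfl⟩ := hD v hv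
    by_cases hlc : l = c
    · rw [hlc]
    · exact absurd hv1 (h1c l (by omega) hlm)
  have hD2 : ∀ D : Finset V, (∀ v ∈ D, ∃ l, c ≤ l ∧ l ≤ m ∧ v = p l) → ∀ v ∈ D, v ∈ S2 → v = p c := by
    intro D hD v hv hv1
    obtain ⟨l, hl, hlm, rfl⟩ := hD v hv
    by_cases hlc : l = c
    · rw [hlc]
    · exact absurd hv1 (h2c l (by omega) hlm)
  have hDR : ∀ D : Finset V, (∀ v ∈ D, ∃ l, c ≤ l ∧ l ≤ m ∧ v = p l) → ∀ v ∈ D, v ∈ R → v = p r := by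
    intro D hD v hv hv1
    obtain ⟨l, hl, hlm, rfl⟩ := hD v hv
    by_cases hlc : l = c
    · subst hlc; exact absurd hv1 hcR
    · rw [hRc l (by omega) hlm hv1]
  have hDS : ∀ D : Finset V, (∀ v ∈ D, ∃ l, c ≤ l ∧ l ≤ m ∧ v = p l) → D ⊆ S := by
    intro D hD v hv
    obtain ⟨l, hl, hlm, rfl⟩ := hD v hv
    exact hpS l hlm
  have hDa : ∀ D : Finset V, (∀ v ∈ D, ∃ l, c ≤ l ∧ l ≤ m ∧ v = p l) → ∀ l, l < a → p l ∉ D := by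
    intro D hD l hl hv
    obtain ⟨l', hl', hlm, he⟩ := hD _ hv
    have := hinj _ _ (by omega) hlm he
    omega
  by_cases hu1 : u ∈ S1
  · obtain ⟨A, B, hA, hB, hAB, hABI⟩ := h1.split hu1
    have hAS : A ⊆ S1 := hAB ▸ Finset.subset_union_left
    have hcA : p c ∉ A := fun hh => huc (hABI _ hh hB.right_mem).symm
    have h2' : i < a ∧ Pth G (p c) (p i) S2 := by
      rcases h2 with ⟨hca, hs, _⟩ | h2
      · rw [hs, Finset.mem_singleton, ← hca] at hu1; exact absurd hu1 huc
      · exact h2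
    refine ⟨r, i, hcr, hrm, h2'.1, fun D hDp hD => ⟨A ∪ R, D ∪ S2, ?_, ?_, ?_, ?_, ?_, ?_, ?_, ?_, ?_⟩⟩
    · exact hA.cat hR (fun v hv hv' => hR1 v hv' (hAS hv))
    · exact hDp.symm.cat h2'.2 (hD2 D hD)
    · intro v hv hv'
      rw [Finset.mem_union] at hv hv'
      rcases hv with hv | hv <;> rcases hv' with hv' | hv'
      · exact absurd hv (hD1 D hD v hv' (hAS hv) ▸ hcA)
      · exact absurd hv (hI v (hAS hv) hv' ▸ hcA)
      · exact hDR D hD v hv' hv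
      · have e1 := hR2 v hv hv'
        subst e1
        exact absurd (hI _ hu1 hv') huc
    · exact Finset.union_subset (hAS.trans hS1) hRS
    · exact Finset.union_subset (hDS D hD) hS2
    · intro v hv; simp [hv]
    · intro l hl hv
      rw [Finset.mem_union] at hv
      rcases hv with hv | hv
      · exact h1a l hl (hAS hv)
      · exact h1a l hl (hRa l hl hv ▸ hu1)
    · intro l hl hv
      rw [Finset.mem_union] at hv
      rcases hv with hv | hv
      · exact absurd hv (hDa D hD l hl)
      · exact h2a l hl hv
    · intro l hl hlm hv
      simp only [Finset.mem_union] at hv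
      rcases hv with (hv | hv) | (hv | hv)
      · exact absurd (hAS hv) (h1c l hl hlm)
      · rw [hRc l hl hlm hv]; exact hDp.right_mem
      · exact hv
      · exact absurd hv (h2c l hl hlm)
  by_cases hu2 : u ∈ S2
  · have h2' : i < a ∧ Pth G (p c) (p i) S2 := by
      rcases h2 with ⟨hca, _, hs⟩ | h2
      · rw [hs, Finset.mem_singleton, ← hca] at hu2; exact absurd hu2 huc
      · exact h2
    obtain ⟨A, B, hA, hB, hAB, hABI⟩ := h2'.2.split hu2
    have hBS : B ⊆ S2 := hAB ▸ Finset.subset_union_right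
    have hcB : p c ∉ B := fun hh => huc (hABI _ hA.left_mem hh).symm
    refine ⟨r, i, hcr, hrm, h2'.1, fun D hDp hD => ⟨S1 ∪ D, R ∪ B, ?_, ?_, ?_, ?_, ?_, ?_, ?_, ?_, ?_⟩⟩
    · exact h1.cat hDp (fun v hv hv' => hD1 D hD v hv' hv)
    · exact hR.symm.cat hB (fun v hv hv' => hR2 v hv (hBS hv'))
    · intro v hv hv'
      rw [Finset.mem_union] at hv hv'
      rcases hv with hv | hv <;> rcases hv' with hv' | hv'
      · exact absurd hv (hR1 v hv' hv ▸ hu1)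
      · exact absurd hv' (hI v hv (hBS hv') ▸ hcB)
      · exact hDR D hD v hv hv'
      · exact absurd hv' (hD2 D hD v hv (hBS hv') ▸ hcB)
    · exact Finset.union_subset hS1 (hDS D hD)
    · exact Finset.union_subset hRS (hBS.trans hS2)
    · intro v hv; simp [hv]
    · intro l hl hv
      rw [Finset.mem_union] at hv
      rcases hv with hv | hv
      · exact h1a l hl hv
      · exact hDa D hD l hl hv
    · intro l hl hv
      rw [Finset.mem_union] at hv
      rcases hv with hv | hv
      · exact h2a l hl (hRa l hl hv ▸ hu2)
      · exact h2a l hl (hBS hv)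
    · intro l hl hlm hv
      simp only [Finset.mem_union] at hv
      rcases hv with (hv | hv) | (hv | hv)
      · exact absurd hv (h1c l hl hlm)
      · exact hv
      · rw [hRc l hl hlm hv]; exact hDp.right_mem
      · exact absurd (hBS hv) (h2c l hl hlm)
  · have : ∃ j, j < a ∧ u = p j := by
      simp only [Finset.mem_union, Finset.mem_image, Finset.mem_range] at hu'
      rcases hu' with (h | h) | ⟨j, hj, rfl⟩
      exacts [absurd h hu1, absurd h hu2, ⟨j, hj, rfl⟩]
    obtain ⟨j, hj, rfl⟩ := this
    refine ⟨r, j, hcr, hrm, hj, fun D hDp hD => ⟨S1 ∪ D, R, ?_, ?_, ?_, ?_, ?_, ?_, ?_, ?_, ?_⟩⟩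
    · exact h1.cat hDp (fun v hv hv' => hD1 D hD v hv' hv)
    · exact hR.symm
    · intro v hv hv'
      rw [Finset.mem_union] at hv
      rcases hv with hv | hv
      · exact absurd hv (hR1 v hv' hv ▸ hu1)
      · exact hDR D hD v hv hv'
    · exact Finset.union_subset hS1 (hDS D hD)
    · exact hRS
    · intro v hv; simp [hv]
    · intro l hl hv
      rw [Finset.mem_union] at hv
      rcases hv with hv | hv
      · exact h1a l hl hv
      · exact hDa D hD l hl hv
    · intro l hl hv
      exact hinj _ _ (by omega) (by omega) (hRa l hl hv)
    · intro l hl hlm hv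
      simp only [Finset.mem_union] at hv
      rcases hv with (hv | hv) | hv
      · exact absurd hv (h1c l hl hlm)
      · exact hv
      · rw [hRc l hl hlm hv]; exact hDp.right_mem

/-- iterate the step until passing `b` -/
lemma vine_iter {S : Finset V} (h : TC G S) {p : ℕ → V} {m : ℕ}
    (hinj : ∀ i j, i ≤ m → j ≤ m → p i = p j → i = j)
    (hadj : ∀ i, i < m → G.Adj (p i) (p (i+1)))
    (hpS : ∀ i, i ≤ m → p i ∈ S)
    {a b : ℕ} (ha : 0 < a) (hbm : b < m) :
    ∀ (N c i : ℕ) (S1 S2 : Finset V), m - c ≤ N → a ≤ c → c ≤ b → Pth G (p a) (p c) S1 →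
    ((c = a ∧ S1 = {p a} ∧ S2 = {p a}) ∨ (i < a ∧ Pth G (p c) (p i) S2)) →
    (∀ v, v ∈ S1 → v ∈ S2 → v = p c) → S1 ⊆ S → S2 ⊆ S →
    (∀ l, l < a → p l ∉ S1) → (∀ l, l < a → p l ∈ S2 → l = i) →
    (∀ l, c < l → l ≤ m → p l ∉ S1) → (∀ l, c < l → l ≤ m → p l ∉ S2) →
    ∃ c r i', c ≤ b ∧ b < r ∧ r ≤ m ∧ i' < a ∧ ∀ D, Pth G (p c) (p r) D →
      (∀ v ∈ D, ∃ l, c ≤ l ∧ l ≤ m ∧ v = p l) →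
      ∃ T, Pth G (p a) (p i') T ∧ D ⊆ T ∧ (∀ l, l < a → p l ∈ T → l = i') := by
  intro N
  induction N with
  | zero => intro c i S1 S2 h0; intros; omega
  | succ N ih =>
    intro c i S1 S2 hN hac hcb h1 h2 hI hS1 hS2 h1a h2a h1c h2c
    obtain ⟨r, i', hcr, hrm, hi', H⟩ := vine_step h hinj hpS ha hac (by omega) h1 h2 hI hS1 hS2
      h1a h2a h1c h2c
    by_cases hrb : r ≤ b
    · obtain ⟨S1', S2', g1, g2, gI, gS1, gS2, gD, g1a, g2a, gc⟩ := H _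
        (Pth.seg hinj hadj c r hcr.le hrm) (by
          intro v hv
          simp only [Finset.mem_image, Finset.mem_Icc] at hv
          obtain ⟨l, hl, rfl⟩ := hv
          exact ⟨l, hl.1, by omega, rfl⟩)
      have key : ∀ l, r < l → l ≤ m → p l ∉ S1' ∪ S2' := by
        intro l hl hlm hv
        have := gc l (by omega) hlm hv
        simp only [Finset.mem_image, Finset.mem_Icc] at this
        obtain ⟨l', hl', he⟩ := this
        have := hinj _ _ (by omega) hlm he
        omega
      exact ih r i' S1' S2' (by omega) (by omega) hrb g1 (Or.inr ⟨hi', g2⟩) gI gS1 gS2 g1a g2a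
        (fun l hl hlm hv => key l hl hlm (Finset.mem_union_left _ hv))
        (fun l hl hlm hv => key l hl hlm (Finset.mem_union_right _ hv))
    · refine ⟨c, r, i', hcb, by omega, hrm, hi', fun D hD hD' => ?_⟩
      obtain ⟨S1', S2', g1, g2, gI, gS1, gS2, gD, g1a, g2a, gc⟩ := H D hD hD'
      refine ⟨S1' ∪ S2', g1.cat g2 gI, gD, fun l hl hv => ?_⟩
      rw [Finset.mem_union] at hv
      rcases hv with hv | hv
      · exact absurd hv (g1a l hl)
      · exact g2a l hl hv

lemma vine_cycle {S : Finset V} (h : TC G S) {p : ℕ → V} {m : ℕ}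
    (hinj : ∀ i j, i ≤ m → j ≤ m → p i = p j → i = j)
    (hadj : ∀ i, i < m → G.Adj (p i) (p (i+1)))
    (hpS : ∀ i, i ≤ m → p i ∈ S)
    {a b : ℕ} (ha : 0 < a) (hab : a ≤ b) (hbm : b < m)
    (h0a : G.Adj (p 0) (p a)) (hmb : G.Adj (p m) (p b)) :
    ∃ x y T, Pth G x y T ∧ G.Adj y x ∧ (∀ l, l ≤ a → (l = 0 ∨ G.Adj (p 0) (p l)) → p l ∈ T) ∧
      (∀ l, b ≤ l → l ≤ m → G.Adj (p m) (p l) → p l ∈ T) := by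
  classical
  obtain ⟨c, r, i, hcb, hbr, hrm, hia, H⟩ := vine_iter h hinj hadj hpS ha hbm (m - a) a 0 {p a} {p a} le_rfl le_rfl hab
    (Pth.nil _) (Or.inl ⟨rfl, rfl, rfl⟩) (by simp) (by simpa using hpS a (by omega))
    (by simpa using hpS a (by omega))
    (by intro l hl hv; rw [Finset.mem_singleton] at hv; have := hinj _ _ (by omega) (by omega) hv; omega)
    (by intro l hl hv; rw [Finset.mem_singleton] at hv; have := hinj _ _ (by omega) (by omega) hv; omega)
    (by intro l hl _ hv; rw [Finset.mem_singleton] at hv; have := hinj _ _ (by omega) (by omega) hv; omega)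
    (by intro l hl _ hv; rw [Finset.mem_singleton] at hv; have := hinj _ _ (by omega) (by omega) hv; omega)
  -- largest neighbour s' of p m below r
  obtain ⟨s', hs', hs'max⟩ := Finset.exists_max_image ((Finset.range r).filter (fun l => G.Adj (p m) (p l))) id
    ⟨b, by simp [hbr, hmb]⟩
  have hbs' : b ≤ s' := hs'max b (by simp [hbr, hmb])
  obtain ⟨hs'r, hs'adj⟩ := by simpa using hs'
  obtain ⟨s, hs, hsmin⟩ := Finset.exists_min_image ((Finset.Ioc i a).filter (fun l => G.Adj (p 0) (p l))) id
    ⟨a, by simp [hia, h0a]⟩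
  obtain ⟨⟨his, hsa⟩, hsadj⟩ := by simpa using hs
  have hD := (Pth.seg hinj hadj c s' (by omega) (by omega)).catAdj hs'adj.symm
    (Pth.seg hinj hadj r m hrm le_rfl).symm (by
      intro v hv hv'
      simp only [Finset.mem_image, Finset.mem_Icc] at hv hv'
      obtain ⟨l, hl, rfl⟩ := hv
      obtain ⟨l', hl', he⟩ := hv'
      have := hinj _ _ (by omega) (by omega) he
      omega)
  obtain ⟨T, hT, hDT, hTa⟩ := H _ hD (by
      intro v hv
      simp only [Finset.mem_union, Finset.mem_image, Finset.mem_Icc] at hv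
      rcases hv with ⟨l, hl, rfl⟩ | ⟨l, hl, rfl⟩
      exacts [⟨l, by omega, by omega, rfl⟩, ⟨l, by omega, by omega, rfl⟩])
  have hfin := ((Pth.seg hinj hadj s a hsa (by omega)).cat hT (by
      intro v hv hv'
      simp only [Finset.mem_image, Finset.mem_Icc] at hv
      obtain ⟨l, hl, rfl⟩ := hv
      by_cases hla : l = a
      · rw [hla]
      · have := hTa l (by omega) hv'
        omega)).cat (Pth.seg hinj hadj 0 i (by omega) (by omega)).symm (by
      intro v hv hv'
      simp only [Finset.mem_union, Finset.mem_image, Finset.mem_Icc] at hv hv'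
      obtain ⟨l, hl, rfl⟩ := hv'
      rcases hv with ⟨l', hl', he⟩ | hv
      · have := hinj _ _ (by omega) (by omega) he
        omega
      · rw [hTa l (by omega) hv])
  refine ⟨_, _, _, hfin, hsadj, ?_, ?_⟩
  · intro l hl hl'
    simp only [Finset.mem_union, Finset.mem_image, Finset.mem_Icc]
    by_cases hli : l ≤ i
    · exact Or.inr ⟨l, by omega, rfl⟩
    · left; left
      refine ⟨l, ⟨?_, hl⟩, rfl⟩
      rcases hl' with hl' | hl'
      · omega
      · exact hsmin l (by simp; exact ⟨⟨by omega, hl⟩, hl'⟩)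
  · intro l hl hlm hl'
    apply Finset.mem_union_left
    apply Finset.mem_union_right
    apply hDT
    simp only [Finset.mem_union, Finset.mem_image, Finset.mem_Icc]
    by_cases hlr : r ≤ l
    · exact Or.inr ⟨l, by omega, rfl⟩
    · left
      refine ⟨l, ⟨by omega, ?_⟩, rfl⟩
      exact hs'max l (by simp; exact ⟨by omega, hl'⟩)

end Vine

section Dirac
variable {V : Type*} [DecidableEq V] {G : SimpleGraph V}

lemma crossing_cycle {p : ℕ → V} {m : ℕ}
    (hinj : ∀ i j, i ≤ m → j ≤ m → p i = p j → i = j)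
    (hadj : ∀ i, i < m → G.Adj (p i) (p (i+1))) {i j : ℕ} (hij : i < j) (hjm : j ≤ m)
    (hi : G.Adj (p m) (p i)) :
    Pth G (p 0) (p j) (((Finset.Icc 0 i) ∪ (Finset.Icc j m)).image p) := by
  rw [Finset.image_union]
  exact (Pth.seg hinj hadj 0 i (by omega) (by omega)).catAdj hi.symm
    (Pth.seg hinj hadj j m hjm le_rfl).symm (by
      intro v hv hv'
      simp only [Finset.mem_image, Finset.mem_Icc] at hv hv'
      obtain ⟨l, hl, rfl⟩ := hv
      obtain ⟨l', hl', he⟩ := hv'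
      have := hinj _ _ (by omega) (by omega) he
      omega)

/-- A cycle spanning `T` can be opened at any vertex. -/
lemma Pth.open_at {x y z : V} {T : Finset V} (h : Pth G x y T) (ha : G.Adj y x) (hz : z ∈ T) :
    ∃ z', Pth G z z' T := by
  by_cases hxz : x = z
  · subst hxz; exact ⟨y, h⟩
  obtain ⟨A, B, hA, hB, hAB, hI⟩ := h.split hz
  obtain ⟨z', hz', -⟩ := hA.pred hxz
  refine ⟨z', ?_⟩
  have := hB.catAdj ha hz' (by
    intro v hv hv'
    rw [Finset.mem_erase] at hv'
    exact hv'.1 (hI v hv'.2 hv))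
  convert this using 1
  rw [← hAB]
  ext v
  simp only [Finset.mem_union, Finset.mem_erase]
  have := hB.left_mem
  by_cases hv : v = z
  · subst hv; simp [this]
  · tauto

theorem dirac_rel {S : Finset V} (h : TC G S) {d : ℕ} (hd : 2 ≤ d) (hS : 2 * d ≤ S.card)
    (hdeg : ∀ v ∈ S, ∀ N : Finset V, (∀ u ∈ S, G.Adj v u → u ∈ N) → d ≤ N.card) :
    ∃ (v : V) (w : G.Walk v v), w.IsCycle ∧ 2 * d ≤ w.length := by
  classical
  suffices hs : ∃ x y T, Pth G x y T ∧ G.Adj y x ∧ 2 * d ≤ T.card by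
    obtain ⟨x, y, T, hT, ha, hc⟩ := hs
    obtain ⟨v, w, hw, hl⟩ := hT.cycle ha (by omega)
    exact ⟨v, w, hw, by omega⟩
  obtain ⟨x0, hx0⟩ : S.Nonempty := Finset.card_pos.1 (by omega)
  obtain ⟨T, hT, hTmax⟩ := Finset.exists_max_image (S.powerset.filter (fun T => ∃ x y, Pth G x y T))
    Finset.card ⟨{x0}, by simp only [Finset.mem_filter, Finset.mem_powerset,
      Finset.singleton_subset_iff]; exact ⟨hx0, x0, x0, Pth.nil x0⟩⟩
  rw [Finset.mem_filter, Finset.mem_powerset] at hT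
  obtain ⟨hTS, x, y, w, hw, hwT⟩ := hT
  have hcard := Pth.card hw hwT
  have hmax : ∀ x y T', Pth G x y T' → T' ⊆ S → T'.card ≤ w.length + 1 := by
    intro x y T' h1 h2
    rw [← hcard]
    exact hTmax T' (by rw [Finset.mem_filter, Finset.mem_powerset]; exact ⟨h2, x, y, h1⟩)
  obtain ⟨p, hp⟩ : ∃ p, p = w.getVert := ⟨_, rfl⟩
  obtain ⟨m, hm⟩ : ∃ m, m = w.length := ⟨_, rfl⟩
  have hinj : ∀ i j, i ≤ m → j ≤ m → p i = p j → i = j := by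
    intro i j hi hj he
    subst hp hm
    exact hw.getVert_injOn hi hj he
  have hadj : ∀ i, i < m → G.Adj (p i) (p (i+1)) := by
    intro i hi
    subst hp hm
    exact w.adj_getVert_succ hi
  have hTp : ∀ v, v ∈ T ↔ ∃ l, l ≤ m ∧ p l = v := by
    intro v
    rw [hwT, Walk.mem_support_iff_exists_getVert, hp, hm]
    simp only [and_comm]
  have hpS : ∀ i, i ≤ m → p i ∈ S := fun i hi => hTS ((hTp _).2 ⟨i, hi, rfl⟩)
  rw [← hm] at hmax hcard
  clear hp hm hwT hw w hTmax
  have hseg : Pth G (p 0) (p m) T := by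
    have := Pth.seg hinj hadj 0 m (by omega) le_rfl
    convert this using 1
    ext v
    rw [hTp]
    simp [and_comm]
  have hext : ∀ a b, Pth G a b T → ∀ z ∈ S, G.Adj a z → z ∈ T := by
    intro a b hab z hz haz
    by_contra hzT
    have h1 := hab.symm.catAdj haz (Pth.nil z) (by
      intro v hv hv'; rw [Finset.mem_singleton] at hv'; subst hv'; exact hzT hv)
    have h2 := hmax _ _ _ h1 (Finset.union_subset hTS (by simpa using hz))
    rw [Finset.card_union_of_disjoint (by simpa using hzT)] at h2
    simp at h2
    omega
  set N0 := (Finset.Icc 1 m).filter (fun l => G.Adj (p 0) (p l)) with hN0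
  set Nm := (Finset.range m).filter (fun l => G.Adj (p m) (p l)) with hNm
  have hN0c : d ≤ N0.card := by
    refine (hdeg (p 0) (hpS 0 (by omega)) (N0.image p) ?_).trans Finset.card_image_le
    intro u hu hau
    obtain ⟨l, hl, rfl⟩ := (hTp u).1 (hext _ _ hseg u hu hau)
    refine Finset.mem_image_of_mem _ ?_
    rw [hN0, Finset.mem_filter, Finset.mem_Icc]
    refine ⟨⟨?_, hl⟩, hau⟩
    by_contra h0
    have : l = 0 := by omega
    subst this
    exact G.loopless.irrefl _ hau
  have hNmc : d ≤ Nm.card := by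
    refine (hdeg (p m) (hpS m le_rfl) (Nm.image p) ?_).trans Finset.card_image_le
    intro u hu hau
    obtain ⟨l, hl, rfl⟩ := (hTp u).1 (hext _ _ hseg.symm u hu hau)
    refine Finset.mem_image_of_mem _ ?_
    rw [hNm, Finset.mem_filter, Finset.mem_range]
    refine ⟨?_, hau⟩
    by_contra h0
    have : l = m := by omega
    subst this
    exact G.loopless.irrefl _ hau
  have hinj' : ∀ J : Finset ℕ, (∀ l ∈ J, l ≤ m) → (J.image p).card = J.card := by
    intro J hJ
    apply Finset.card_image_of_injOn
    intro a ha b hb hab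
    exact hinj a b (hJ a ha) (hJ b hb) hab
  by_cases hcross : ∃ k i j, i < j ∧ i ∈ Nm ∧ j ∈ N0 ∧ j - i = k
  · have hfind := Nat.find_spec hcross
    have hmin := fun k hk => Nat.find_min (m := k) hcross hk
    generalize Nat.find hcross = k at hfind hmin
    obtain ⟨i, j, hij, hi, hj, hk⟩ := hfind
    have hnone : ∀ i' j', i ≤ i' → j' ≤ j → i' < j' → i' ∈ Nm → j' ∈ N0 → i' = i ∧ j' = j := by
      intro i' j' h1 h2 h3 h4 h5
      by_contra hne
      exact hmin (j' - i') (by omega) ⟨i', j', h3, h4, h5, rfl⟩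
    have hgap : ∀ i' j', i' ∈ Nm → j' ∈ N0 → i' < j' → j - i ≤ j' - i' := by
      intro i' j' h1 h2 h3
      by_contra hne
      exact hmin (j' - i') (by omega) ⟨i', j', h3, h1, h2, rfl⟩
    have hi' := (Finset.mem_filter.1 hi)
    have hj' := (Finset.mem_filter.1 hj)
    have him := Finset.mem_range.1 hi'.1
    have hjm := Finset.mem_Icc.1 hj'.1
    have hcyc := crossing_cycle hinj hadj hij hjm.2 hi'.2
    have hJ : ∀ l ∈ (Finset.Icc 0 i) ∪ (Finset.Icc j m), l ≤ m := by
      intro l hl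
      simp only [Finset.mem_union, Finset.mem_Icc] at hl
      omega
    have hJc : ((Finset.Icc 0 i) ∪ (Finset.Icc j m)).card = (i + 1) + (m + 1 - j) := by
      rw [Finset.card_union_of_disjoint]
      · simp
      · rw [Finset.disjoint_left]
        intro l hl hl'
        simp only [Finset.mem_Icc] at hl hl'
        omega
    by_cases hji : j = i + 1
    · -- the cycle spans the path, hence all of S
      have hTeq : ((Finset.Icc 0 i) ∪ (Finset.Icc j m)).image p = T := by
        ext v
        rw [hTp]
        simp only [Finset.mem_image, Finset.mem_union, Finset.mem_Icc]
        constructor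
        · rintro ⟨l, hl, rfl⟩
          exact ⟨l, by omega, rfl⟩
        · rintro ⟨l, hl, rfl⟩
          exact ⟨l, by omega, rfl⟩
      rw [hTeq] at hcyc
      have hTS' : T = S := by
        by_contra hne
        obtain ⟨a, b, ha, -, hb, hb', hab⟩ := h T (S \ T) (Finset.union_sdiff_of_subset hTS) hne
          (by
            intro he
            have h1 := hseg.left_mem
            have h2 := hTS h1
            rw [← he, Finset.mem_sdiff] at h2
            exact h2.2 h1)
          (by simp)
        obtain ⟨z, hz⟩ := hcyc.open_at hj'.2.symm ha
        exact hb' (hext _ _ hz b (Finset.mem_sdiff.1 hb).1 hab)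
      exact ⟨_, _, _, hcyc, hj'.2.symm, by rw [hTS']; exact hS⟩
    · refine ⟨_, _, _, hcyc, hj'.2.symm, ?_⟩
      rw [hinj' _ hJ, hJc]
      have hdisj : Disjoint N0 (Nm.image (· + 1)) := by
        rw [Finset.disjoint_left]
        intro l hl hl'
        obtain ⟨l', hl2, rfl⟩ := Finset.mem_image.1 hl'
        have := hgap l' (l' + 1) hl2 hl (by omega)
        omega
      have hsub : N0 ∪ Nm.image (· + 1) ⊆ (Finset.Icc 1 (i+1)) ∪ (Finset.Icc j m) := by
        intro l hl
        rw [Finset.mem_union] at hl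
        simp only [Finset.mem_union, Finset.mem_Icc]
        rcases hl with hl | hl
        · have h1 := Finset.mem_Icc.1 (Finset.mem_filter.1 hl).1
          by_contra hn
          have := hnone i l le_rfl (by omega) (by omega) hi hl
          omega
        · obtain ⟨l', hl', rfl⟩ := Finset.mem_image.1 hl
          have h1 := Finset.mem_range.1 (Finset.mem_filter.1 hl').1
          by_contra hn
          have := hnone l' j (by omega) le_rfl (by omega) hl' hj
          omega
      have hc := Finset.card_le_card hsub
      rw [Finset.card_union_of_disjoint hdisj,
        Finset.card_image_of_injective _ (add_left_injective 1)] at hc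
      have hc2 := hc.trans (Finset.card_union_le _ _)
      simp only [Nat.card_Icc] at hc2
      omega
  · have hN0n : N0.Nonempty := Finset.card_pos.1 (by omega)
    have hNmn : Nm.Nonempty := Finset.card_pos.1 (by omega)
    obtain ⟨a, ha, hamax⟩ := Finset.exists_max_image N0 id hN0n
    obtain ⟨b, hb, hbmin⟩ := Finset.exists_min_image Nm id hNmn
    have hab : a ≤ b := by
      by_contra hn
      exact hcross ⟨_, b, a, by omega, hb, ha, rfl⟩
    have ha' := Finset.mem_filter.1 ha
    have hb' := Finset.mem_filter.1 hb
    have ha1 := Finset.mem_Icc.1 ha'.1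
    have hb1 := Finset.mem_range.1 hb'.1
    obtain ⟨x, y, T', hT', hxy, h1, h2⟩ := vine_cycle h hinj hadj hpS (a := a) (b := b) (by omega) hab hb1 ha'.2 hb'.2
    refine ⟨x, y, T', hT', hxy, ?_⟩
    have hdisj : Disjoint (insert 0 (N0.erase a)) Nm := by
      rw [Finset.disjoint_left]
      intro l hl hl'
      have h3 : b ≤ l := hbmin l hl'
      rw [Finset.mem_insert, Finset.mem_erase] at hl
      rcases hl with hl | ⟨hl, hl2⟩
      · omega
      · have : l ≤ a := hamax l hl2
        omega
    have hc0 : d ≤ (insert 0 (N0.erase a)).card := by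
      rw [Finset.card_insert_of_notMem, Finset.card_erase_of_mem ha]
      · omega
      · simp [hN0]
    have hle : ∀ l ∈ insert 0 (N0.erase a) ∪ Nm, l ≤ m := by
      intro l hl
      simp only [Finset.mem_union, Finset.mem_insert, Finset.mem_erase, hN0, hNm, Finset.mem_filter,
        Finset.mem_Icc, Finset.mem_range] at hl
      omega
    calc 2 * d ≤ (insert 0 (N0.erase a)).card + Nm.card := by omega
      _ = ((insert 0 (N0.erase a) ∪ Nm).image p).card := by
        rw [hinj' _ hle, Finset.card_union_of_disjoint hdisj]
      _ ≤ T'.card := by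
        apply Finset.card_le_card
        intro v hv
        obtain ⟨l, hl, rfl⟩ := Finset.mem_image.1 hv
        rw [Finset.mem_union, Finset.mem_insert, Finset.mem_erase] at hl
        rcases hl with (hl | ⟨_, hl⟩) | hl
        · exact h1 l (by omega) (Or.inl hl)
        · exact h1 l (hamax l hl) (Or.inr (Finset.mem_filter.1 hl).2)
        · exact h2 l (hbmin l hl) (Finset.mem_range.1 (Finset.mem_filter.1 hl).1).le
            (Finset.mem_filter.1 hl).2

end Dirac

section Upper
variable {V : Type*}

open Classical in
/-- number of ordered adjacent pairs inside `S` -/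
noncomputable def e2 (G : SimpleGraph V) (S : Finset V) : ℕ :=
  ((S ×ˢ S).filter (fun q => G.Adj q.1 q.2)).card

lemma e2_univ [Fintype V] (G : SimpleGraph V) : e2 G Finset.univ = 2 * edgeCount G := by
  classical
  have h1 : edgeCount G = G.edgeFinset.card := by
    rw [edgeCount, ← coe_edgeFinset, Set.ncard_coe_finset]
  rw [h1, ← dart_card_eq_twice_card_edges, e2, ← Finset.card_univ]
  symm
  apply Finset.card_bij (fun (d : G.Dart) _ => (d.fst, d.snd))
  · intro d _; simp [d.adj]
  · intro d _ d' _ h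
    ext
    · exact (Prod.ext_iff.1 h).1
    · exact (Prod.ext_iff.1 h).2
  · rintro ⟨x, y⟩ h
    simp at h
    exact ⟨⟨(x, y), h⟩, by simp, rfl⟩

lemma e2_le_sq (G : SimpleGraph V) (S : Finset V) : e2 G S ≤ S.card * (S.card - 1) := by
  classical
  have : e2 G S ≤ S.offDiag.card := by
    apply Finset.card_le_card
    rintro ⟨x, y⟩ h
    simp only [Finset.mem_filter, Finset.mem_product, Finset.mem_offDiag] at h ⊢
    exact ⟨h.1.1, h.1.2, h.2.ne⟩
  rw [Finset.offDiag_card] at this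
  rw [Nat.mul_sub, mul_one]
  exact this

variable [DecidableEq V]

lemma e2_erase (G : SimpleGraph V) (S : Finset V) (v : V) (N : Finset V)
    (hN : ∀ u ∈ S, G.Adj v u → u ∈ N) : e2 G S ≤ e2 G (S.erase v) + 2 * N.card := by
  classical
  have : (S ×ˢ S).filter (fun q => G.Adj q.1 q.2) ⊆
      ((S.erase v ×ˢ S.erase v).filter (fun q => G.Adj q.1 q.2)) ∪
        (N.image (fun u => (v, u)) ∪ N.image (fun u => (u, v))) := by
    rintro ⟨x, y⟩ h
    simp only [Finset.mem_filter, Finset.mem_product, Finset.mem_union, Finset.mem_image,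
      Finset.mem_erase, Prod.mk.injEq] at h ⊢
    obtain ⟨⟨hx, hy⟩, hxy⟩ := h
    by_cases hxv : x = v
    · subst hxv
      exact Or.inr (Or.inl ⟨y, hN y hy hxy, rfl, rfl⟩)
    by_cases hyv : y = v
    · subst hyv
      exact Or.inr (Or.inr ⟨x, hN x hx hxy.symm, rfl, rfl⟩)
    exact Or.inl ⟨⟨⟨hxv, hx⟩, hyv, hy⟩, hxy⟩
  have h1 := (Finset.card_le_card this).trans (Finset.card_union_le _ _)
  have h2 := Finset.card_union_le (N.image (fun u => (v, u))) (N.image (fun u => (u, v)))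
  have h3 : (N.image (fun u => (v, u))).card ≤ N.card := Finset.card_image_le
  have h4 : (N.image (fun u => (u, v))).card ≤ N.card := Finset.card_image_le
  unfold e2
  refine h1.trans ?_
  omega

lemma e2_union (G : SimpleGraph V) (A B : Finset V)
    (h : ∀ a b, a ∈ A → a ∉ B → b ∈ B → b ∉ A → ¬ G.Adj a b) : e2 G (A ∪ B) ≤ e2 G A + e2 G B := by
  classical
  refine le_trans (Finset.card_le_card ?_) (Finset.card_union_le _ _)
  rintro ⟨x, y⟩ hq
  simp only [Finset.mem_filter, Finset.mem_product, Finset.mem_union] at hq ⊢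
  obtain ⟨⟨hx, hy⟩, hxy⟩ := hq
  have h1 := fun a b c d => h x y a b c d hxy
  have h2 := fun a b c d => h y x a b c d hxy.symm
  tauto

theorem upper (G : SimpleGraph V) (t : ℕ) (ht : 1 ≤ t) (M : ℝ) (hM : (t : ℝ) ≤ M)
    (hcyc : ¬ HasCycleGE G (2 * t + 2))
    (hEx : ∀ S : Finset V, S.card = 2 * t + 1 → (e2 G S : ℝ) ≤ 2 * M * (2 * t)) :
    ∀ (n : ℕ) (S : Finset V), S.card = n → S.Nonempty → (e2 G S : ℝ) ≤ 2 * M * ((n : ℝ) - 1) := by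
  intro n
  induction n using Nat.strong_induction_on with
  | _ n ih =>
  intro S hSn hS
  have hn1 : 1 ≤ n := hSn ▸ Finset.card_pos.2 hS
  have hn1' : (1 : ℝ) ≤ n := by exact_mod_cast hn1
  by_cases hsmall : n ≤ 2 * t
  · have h1 := e2_le_sq G S
    rw [hSn] at h1
    have h2 : (e2 G S : ℝ) ≤ n * ((n : ℝ) - 1) := by
      have : ((n * (n - 1) : ℕ) : ℝ) = n * ((n : ℝ) - 1) := by push_cast [hn1]; ring
      rw [← this]; exact_mod_cast h1
    have h3 : (n : ℝ) ≤ 2 * t := by exact_mod_cast hsmall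
    refine h2.trans (mul_le_mul_of_nonneg_right (by linarith) (by linarith))
  by_cases hmid : n = 2 * t + 1
  · have := hEx S (by omega)
    rw [hmid]
    push_cast
    linarith
  by_cases hdeg : ∀ v ∈ S, ∀ N : Finset V, (∀ u ∈ S, G.Adj v u → u ∈ N) → t + 1 ≤ N.card
  · by_cases hTC : TC G S
    · obtain ⟨v, w, hw, hl⟩ := dirac_rel hTC (d := t + 1) (by omega) (by omega) hdeg
      exact absurd ⟨v, w, hw, by omega⟩ hcyc
    · unfold TC at hTC
      push Not at hTC
      obtain ⟨A, B, hAB, hA, hB, hc, hno⟩ := hTC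
      have hAS : A ⊂ S := Finset.ssubset_iff_subset_ne.2 ⟨hAB ▸ Finset.subset_union_left, hA⟩
      have hBS : B ⊂ S := Finset.ssubset_iff_subset_ne.2 ⟨hAB ▸ Finset.subset_union_right, hB⟩
      have hAc := Finset.card_lt_card hAS
      have hBc := Finset.card_lt_card hBS
      have hAn : A.Nonempty := by
        rw [Finset.nonempty_iff_ne_empty]; rintro rfl; simp at hAB; exact hB hAB
      have hBn : B.Nonempty := by
        rw [Finset.nonempty_iff_ne_empty]; rintro rfl; simp at hAB; exact hA hAB
      have h1 := ih A.card (by omega) A rfl hAn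
      have h2 := ih B.card (by omega) B rfl hBn
      have h3 := e2_union G A B hno
      rw [hAB] at h3
      have h4 := Finset.card_union_add_card_inter A B
      rw [hAB] at h4
      have h5 : (A.card : ℝ) + B.card ≤ n + 1 := by
        have : A.card + B.card ≤ n + 1 := by omega
        exact_mod_cast this
      have h6 : (e2 G S : ℝ) ≤ e2 G A + e2 G B := by exact_mod_cast h3
      have h7 : (0 : ℝ) ≤ 2 * M := by
        have : (0 : ℝ) ≤ t := Nat.cast_nonneg t
        linarith
      nlinarith
  · push Not at hdeg
    obtain ⟨v, hv, N, hN, hNc⟩ := hdeg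
    have h1 := e2_erase G S v N hN
    have hcard := Finset.card_erase_of_mem hv
    have h2 := ih (n - 1) (by omega) (S.erase v) (by omega) (Finset.card_pos.1 (by omega))
    rw [Nat.cast_sub hn1] at h2
    have h3 : (e2 G S : ℝ) ≤ e2 G (S.erase v) + 2 * N.card := by exact_mod_cast h1
    have h4 : (N.card : ℝ) ≤ t := by exact_mod_cast (by omega : N.card ≤ t)
    push_cast at h2
    linarith

lemma le_exMax {n : ℕ} {P : SimpleGraph (Fin n) → Prop} (G : SimpleGraph (Fin n)) (h : P G) :
    edgeCount G ≤ exMax n P := by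
  apply le_csSup
  · apply Set.Finite.bddAbove
    apply (Set.finite_range (fun G : SimpleGraph (Fin n) => edgeCount G)).subset
    rintro m ⟨G, -, rfl⟩
    exact ⟨G, rfl⟩
  · exact ⟨G, h, rfl⟩

lemma exMax_spec {n : ℕ} {P : SimpleGraph (Fin n) → Prop} (hP : ∃ G, P G) :
    ∃ G, P G ∧ edgeCount G = exMax n P := by
  obtain ⟨G, hG⟩ := hP
  have : exMax n P ∈ {m | ∃ G : SimpleGraph (Fin n), P G ∧ edgeCount G = m} := by
    refine Nat.sSup_mem (s := {m | ∃ G : SimpleGraph (Fin n), P G ∧ edgeCount G = m})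
      ⟨_, G, hG, rfl⟩ ?_
    apply Set.Finite.bddAbove
    apply (Set.finite_range (fun G : SimpleGraph (Fin n) => edgeCount G)).subset
    rintro m ⟨G, -, rfl⟩
    exact ⟨G, rfl⟩
  exact this

lemma e2_le_exMax {α : Type*} (F : SimpleGraph α) (G : SimpleGraph V) (hF : ¬ ContainsCopy F G)
    (S : Finset V) (n : ℕ) (hS : S.card = n) :
    e2 G S ≤ 2 * exMax n (fun H => ¬ ContainsCopy F H) := by
  classical
  let e : Fin n ≃ S := (S.equivFinOfCardEq hS).symm
  let H : SimpleGraph (Fin n) := G.comap (fun i => (e i : V))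
  have hH : ¬ ContainsCopy F H := by
    rintro ⟨f, hf, hfa⟩
    exact hF ⟨fun a => (e (f a) : V), fun a b hab => hf (e.injective (Subtype.ext hab)),
      fun a b hab => hfa hab⟩
  have h1 := le_exMax (P := fun H => ¬ ContainsCopy F H) H hH
  have h2 : e2 G S ≤ e2 H Finset.univ := by
    apply Finset.card_le_card_of_surjOn (fun q => ((e q.1 : V), (e q.2 : V)))
    rintro ⟨x, y⟩ hq
    simp only [Finset.coe_filter, Finset.mem_product, Set.mem_ofPred_eq] at hq
    refine ⟨(e.symm ⟨x, hq.1.1⟩, e.symm ⟨y, hq.1.2⟩), ?_, by simp⟩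
    simp [H, hq.2]
  rw [e2_univ] at h2
  omega

end Upper

section Lower

/-- complete bipartite graph on `Fin n` with parts `{i < t}` and `{i ≥ t}` -/
def bip (n t : ℕ) : SimpleGraph (Fin n) where
  Adj i j := ¬ (i.1 < t ↔ j.1 < t)
  symm := ⟨fun i j h => by tauto⟩
  loopless := ⟨fun i h => h Iff.rfl⟩

lemma bip_partCard (n t : ℕ) (h : t ≤ n) :
    (Finset.univ.filter (fun i : Fin n => i.1 < t)).card = t := by
  rw [Fin.card_filter_val_lt]; omega

lemma bip_edges (n t : ℕ) (h : t ≤ n) : t * (n - t) ≤ edgeCount (bip n t) := by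
  classical
  have h1 := e2_univ (bip n t)
  set A := Finset.univ.filter (fun i : Fin n => i.1 < t) with hA
  have hAc : A.card = t := bip_partCard n t h
  have hAc' : Aᶜ.card = n - t := by rw [Finset.card_compl, hAc, Fintype.card_fin]
  have h2 : (A ×ˢ Aᶜ ∪ Aᶜ ×ˢ A).card ≤ e2 (bip n t) Finset.univ := by
    apply Finset.card_le_card
    rintro ⟨x, y⟩ hq
    simp only [hA, Finset.mem_union, Finset.mem_product, Finset.mem_compl, Finset.mem_filter,
      Finset.mem_univ, true_and] at hq
    rw [Finset.mem_filter]
    refine ⟨by simp, ?_⟩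
    change ¬ (x.1 < t ↔ y.1 < t)
    tauto
  rw [Finset.card_union_of_disjoint, Finset.card_product, Finset.card_product, hAc, hAc'] at h2
  · have : (n - t) * t = t * (n - t) := mul_comm _ _
    omega
  · rw [Finset.disjoint_left]
    rintro ⟨x, y⟩ hq hq'
    simp only [Finset.mem_product, Finset.mem_compl] at hq hq'
    exact hq'.1 hq.1

lemma nodup_count_le {n t : ℕ} (h : t ≤ n) (l : List (Fin n)) (hl : l.Nodup) :
    l.countP (fun i => decide (i.1 < t)) ≤ t := by
  classical
  rw [List.countP_eq_length_filter, ← List.toFinset_card_of_nodup (hl.filter _)]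
  refine le_trans (Finset.card_le_card ?_) (bip_partCard n t h).le
  intro x hx
  simpa using (List.mem_filter.1 (List.mem_toFinset.1 hx)).2

lemma bip_count {n t : ℕ} {x y : Fin n} (w : (bip n t).Walk x y) :
    w.length ≤ w.support.tail.countP (fun i => decide (i.1 < t)) +
      w.support.dropLast.countP (fun i => decide (i.1 < t)) := by
  induction w with
  | nil => simp
  | @cons u v z h w ih =>
    have e1 : (Walk.cons h w).support.tail = v :: w.support.tail := by
      simp
    have e2 : (Walk.cons h w).support.dropLast = u :: w.support.dropLast := by
      rw [Walk.support_cons, List.dropLast_cons_of_ne_nil (Walk.support_ne_nil _)]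
    rw [e1, e2, List.countP_cons, List.countP_cons, Walk.length_cons]
    have h' : ¬ (u.1 < t ↔ v.1 < t) := h
    by_cases h1 : u.1 < t <;> by_cases h2 : v.1 < t <;> simp [h1, h2] at h' ⊢ <;> omega

lemma bip_cycle (n t : ℕ) (h : t ≤ n) : ¬ HasCycleGE (bip n t) (2 * t + 2) := by
  rintro ⟨v, w, hw, hl⟩
  have h1 := bip_count w
  have h2 := nodup_count_le h _ hw.support_nodup
  have h3 : w.support.dropLast.Nodup := by
    have := hw.reverse.support_nodup
    rw [Walk.support_reverse, List.tail_reverse, List.nodup_reverse] at this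
    exact this
  have h4 := nodup_count_le h _ h3
  omega

lemma bip_copy {α : Type*} [Fintype α] (F : SimpleGraph α) (n t : ℕ) (h : t ≤ n)
    (hF : PGE F (t + 1)) : ¬ ContainsCopy F (bip n t) := by
  classical
  rintro ⟨f, hf, hfa⟩
  have := (hF (fun a => decide ((f a).1 < t)) (by
    intro a b hab he
    apply hfa hab
    simpa using he)).1
  have h2 : {a | (fun a => decide ((f a).1 < t)) a = true}.ncard ≤
      (↑(Finset.univ.filter (fun i : Fin n => i.1 < t)) : Set (Fin n)).ncard := by
    apply Set.ncard_le_ncard_of_injOn f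
    · intro a ha
      simpa using ha
    · exact hf.injOn
  rw [Set.ncard_coe_finset, bip_partCard n t h] at h2
  exact absurd (this.trans h2) (by omega)

/-- projection of the glued graph to a single block -/
def gphi (q : ℕ) (hq : 0 < q) (x : ℕ) : Fin (q + 1) :=
  if x = 0 then 0 else ⟨(x - 1) % q + 1, Nat.succ_lt_succ (Nat.mod_lt _ hq)⟩

lemma gphi_inj (q : ℕ) (hq : 0 < q) {x y β : ℕ} (hx : x = 0 ∨ (x - 1) / q = β)
    (hy : y = 0 ∨ (y - 1) / q = β) (h : gphi q hq x = gphi q hq y) : x = y := by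
  unfold gphi at h
  have hv := congrArg Fin.val h
  by_cases hx0 : x = 0 <;> by_cases hy0 : y = 0
  · omega
  · simp [hx0, hy0] at hv
  · simp [hx0, hy0] at hv
  · simp [hx0, hy0] at hv
    have h1 := Nat.div_add_mod (x - 1) q
    have h2 := Nat.div_add_mod (y - 1) q
    rw [hx.resolve_left hx0, hv] at h1
    rw [hy.resolve_left hy0] at h2
    omega

/-- blocks `H` glued along a common vertex -/
def glue (q : ℕ) (hq : 0 < q) (H : SimpleGraph (Fin (q + 1))) (n : ℕ) : SimpleGraph (Fin n) where
  Adj x y := (x.1 = 0 ∨ y.1 = 0 ∨ (x.1 - 1) / q = (y.1 - 1) / q) ∧ H.Adj (gphi q hq x) (gphi q hq y)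
  symm := ⟨fun x y h => ⟨by rcases h.1 with h | h | h <;> simp [h], h.2.symm⟩⟩
  loopless := ⟨fun x h => H.loopless.irrefl _ h.2⟩

variable {q : ℕ} {hq : 0 < q} {H : SimpleGraph (Fin (q + 1))} {n : ℕ}

lemma glue_walk {x y : Fin n} (w : (glue q hq H n).Walk x y) (h0 : ∀ z ∈ w.support, z.1 ≠ 0) :
    ∀ z ∈ w.support, (z.1 - 1) / q = (x.1 - 1) / q := by
  induction w with
  | nil => intro z hz; simp at hz; rw [hz]
  | @cons u v z h w ih =>
    have hu := h0 u (by simp)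
    have hv := h0 v (by simp)
    have ih' := ih (fun z hz => h0 z (by simp [hz]))
    have huv : (u.1 - 1) / q = (v.1 - 1) / q := (h.1.resolve_left hu).resolve_left hv
    intro z' hz'
    rw [Walk.support_cons, List.mem_cons] at hz'
    rcases hz' with rfl | hz'
    · rfl
    · rw [ih' z' hz', huv]

lemma glue_path {x y : Fin n} (w : (glue q hq H n).Walk x y) (hw : w.IsPath) (hy : y.1 = 0) :
    ∀ z ∈ w.support, z.1 = 0 ∨ (z.1 - 1) / q = (x.1 - 1) / q := by
  induction w with
  | nil => intro z hz; simp at hz; rw [hz]; simp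
  | @cons u v y h w ih =>
    rw [Walk.cons_isPath_iff] at hw
    have ih' := ih hw.1 hy
    have hu : u.1 ≠ 0 := by
      intro hu
      have : u = y := Fin.ext (by omega)
      subst this
      exact hw.2 w.end_mem_support
    intro z' hz'
    rw [Walk.support_cons, List.mem_cons] at hz'
    rcases hz' with rfl | hz'
    · right; rfl
    by_cases hv : v.1 = 0
    · have : v = y := Fin.ext (by omega)
      subst this
      have hnil := hw.1
      rw [Walk.isPath_iff_nil, Walk.nil_iff_support_eq] at hnil
      rw [hnil, List.mem_singleton] at hz'
      left; rw [hz']; exact hv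
    · have huv : (u.1 - 1) / q = (v.1 - 1) / q := (h.1.resolve_left hu).resolve_left hv
      rw [huv]
      exact ih' z' hz'

lemma glue_cycle : ¬ HasCycleGE (glue q hq H n) (q + 2) := by
  classical
  rintro ⟨v, w, hw, hl⟩
  have key : ∃ β, ∀ z ∈ w.support, z.1 = 0 ∨ (z.1 - 1) / q = β := by
    by_cases h0 : ∀ z ∈ w.support, z.1 ≠ 0
    · exact ⟨_, fun z hz => Or.inr (glue_walk w h0 z hz)⟩
    · push Not at h0
      obtain ⟨o, ho, ho0⟩ := h0
      have hw' := hw.rotate ho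
      have hsup : ∀ z, z ∈ w.support → z ∈ (w.rotate o ho).support := by
        intro z hz
        simpa using hz
      generalize w.rotate o ho = w' at hw' hsup
      cases w' with
      | nil => simp at hw'
      | @cons _ z _ h w' =>
        rw [Walk.cons_isCycle_iff] at hw'
        refine ⟨(z.1 - 1) / q, fun z' hz' => ?_⟩
        have := hsup z' hz'
        rw [Walk.support_cons, List.mem_cons] at this
        rcases this with rfl | h
        · exact Or.inl ho0
        · exact glue_path w' hw'.1 ho0 z' h
  obtain ⟨β, hβ⟩ := key
  have hnd := hw.support_nodup
  have hcard : w.support.tail.toFinset.card = w.length := by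
    rw [List.toFinset_card_of_nodup hnd]; simp
  have : w.support.tail.toFinset.card ≤ (Finset.univ : Finset (Fin (q + 1))).card := by
    apply Finset.card_le_card_of_injOn (fun z => gphi q hq z.1)
    · intro z _; simp
    · intro x hx y hy hxy
      have hx' := hβ x (List.mem_of_mem_tail (by simpa using hx))
      have hy' := hβ y (List.mem_of_mem_tail (by simpa using hy))
      exact Fin.ext (gphi_inj q hq hx' hy' hxy)
  rw [hcard, Finset.card_univ, Fintype.card_fin] at this
  omega

lemma const_of_connected {α γ : Type*} {F : SimpleGraph α} (hF : F.Connected) (g : α → γ)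
    (hg : ∀ a b, F.Adj a b → g a = g b) (a b : α) : g a = g b := by
  obtain ⟨w⟩ := hF.preconnected a b
  induction w with
  | nil => rfl
  | cons h w ih => exact (hg _ _ h).trans ih

lemma glue_copy {α : Type*} [Fintype α] {F : SimpleGraph α} (hF : TwoConnected F)
    (hH : ¬ ContainsCopy F H) : ¬ ContainsCopy F (glue q hq H n) := by
  classical
  rintro ⟨f, hf, hfa⟩
  have key : ∃ β, ∀ a, (f a).1 = 0 ∨ ((f a).1 - 1) / q = β := by
    by_cases h0 : ∃ o, (f o).1 = 0
    · obtain ⟨o, ho⟩ := h0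
      have hc := hF.2.2 o
      obtain ⟨o', ho'⟩ := hc.nonempty
      refine ⟨((f o').1 - 1) / q, fun a => ?_⟩
      by_cases hao : a = o
      · left; rw [hao]; exact ho
      · right
        have hne : ∀ c : ({o}ᶜ : Set α), (f c).1 ≠ 0 := by
          intro c hc0
          exact c.2 (hf (Fin.ext (by omega)))
        exact const_of_connected hc (fun c => ((f c.1).1 - 1) / q) (by
          intro a b hab
          exact ((hfa hab).1.resolve_left (hne a)).resolve_left (hne b)) ⟨a, hao⟩ ⟨o', ho'⟩
    · push Not at h0
      obtain ⟨o⟩ := hF.2.1.nonempty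
      exact ⟨((f o).1 - 1) / q, fun a => Or.inr (const_of_connected hF.2.1
        (fun c => ((f c).1 - 1) / q) (by
          intro a b hab
          exact ((hfa hab).1.resolve_left (h0 a)).resolve_left (h0 b)) a o)⟩
  obtain ⟨β, hβ⟩ := key
  exact hH ⟨fun a => gphi q hq (f a).1, fun a b hab =>
    hf (Fin.ext (gphi_inj q hq (hβ a) (hβ b) hab)), fun a b hab => (hfa hab).2⟩

/-- embedding of the block `i` -/
def gemb (q i x : ℕ) : ℕ := if x = 0 then 0 else i * q + x

lemma gphi_gemb (i : ℕ) (x : Fin (q + 1)) : gphi q hq (gemb q i x) = x := by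
  unfold gphi gemb
  apply Fin.ext
  by_cases hx : x.1 = 0
  · simp [hx]
  · have h1 : i * q + x.1 ≠ 0 := by omega
    have h2 : i * q + x.1 - 1 = (x.1 - 1) + q * i := by rw [mul_comm q i]; omega
    simp only [hx, h1, if_false]
    rw [h2, Nat.add_mul_mod_self_left, Nat.mod_eq_of_lt (by omega)]
    omega

lemma gemb_blk (hq : 0 < q) (i : ℕ) (x : Fin (q + 1)) (hx : x.1 ≠ 0) : (gemb q i x - 1) / q = i := by
  unfold gemb
  have h2 : i * q + x.1 - 1 = (x.1 - 1) + q * i := by rw [mul_comm q i]; omega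
  rw [if_neg hx, h2, Nat.add_mul_div_left _ _ hq, Nat.div_eq_of_lt (by omega)]
  omega

lemma glue_edges (hn : 0 < n) : ((n - 1) / q) * edgeCount H ≤ edgeCount (glue q hq H n) := by
  classical
  have h1 := e2_univ (glue q hq H n)
  have h2 := e2_univ H
  set Q := (n - 1) / q with hQ
  have hlt : ∀ (i : Fin Q) (x : Fin (q + 1)), gemb q i x < n := by
    intro i x
    unfold gemb
    split_ifs
    · exact hn
    · have h3 : (i.1 + 1) * q ≤ Q * q := Nat.mul_le_mul_right q i.2
      have h4 : Q * q ≤ n - 1 := Nat.div_mul_le_self _ _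
      rw [Nat.add_mul, one_mul] at h3
      have := x.2
      omega
  have h3 : ((Finset.univ : Finset (Fin Q)) ×ˢ
      ((Finset.univ ×ˢ Finset.univ).filter (fun p : Fin (q+1) × Fin (q+1) => H.Adj p.1 p.2))).card ≤
      e2 (glue q hq H n) Finset.univ := by
    apply Finset.card_le_card_of_injOn
      (fun r => ((⟨gemb q r.1 r.2.1, hlt _ _⟩ : Fin n), (⟨gemb q r.1 r.2.2, hlt _ _⟩ : Fin n)))
    · rintro ⟨i, x, y⟩ hr
      simp only [Finset.coe_product, Set.mem_prod, Finset.coe_filter, Finset.mem_product,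
        Finset.mem_univ, true_and, and_self, Set.mem_ofPred_eq, Finset.coe_univ, Set.mem_univ] at hr ⊢
      refine ⟨?_, ?_⟩
      · by_cases hx : x.1 = 0
        · left; simp [gemb, hx]
        by_cases hy : y.1 = 0
        · right; left; simp [gemb, hy]
        right; right
        simp only []
        rw [gemb_blk hq _ _ hx, gemb_blk hq _ _ hy]
      · simp only [gphi_gemb]
        exact hr
    · rintro ⟨i, x, y⟩ hr ⟨i', x', y'⟩ hr' he
      simp only [Finset.coe_product, Set.mem_prod, Finset.coe_filter, Finset.mem_product,
        Finset.mem_univ, true_and, and_self, Set.mem_ofPred_eq, Finset.coe_univ, Set.mem_univ] at hr hr'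
      simp only [Prod.mk.injEq, Fin.mk.injEq] at he
      obtain ⟨e1, e2⟩ := he
      have hx : x = x' := by rw [← gphi_gemb (hq := hq) i x, e1, gphi_gemb]
      have hy : y = y' := by rw [← gphi_gemb (hq := hq) i y, e2, gphi_gemb]
      subst hx hy
      have hi : i = i' := by
        apply Fin.ext
        by_cases hx0 : x.1 = 0
        · have hy0 : y.1 ≠ 0 := by
            intro hy0
            exact hr.ne (Fin.ext (by omega))
          rw [← gemb_blk hq i y hy0, e2, gemb_blk hq _ y hy0]
        · rw [← gemb_blk hq i x hx0, e1, gemb_blk hq _ x hx0]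
      rw [hi]
  rw [Finset.card_product, Finset.card_univ, Fintype.card_fin] at h3
  have h4 : ((Finset.univ ×ˢ Finset.univ).filter
      (fun p : Fin (q+1) × Fin (q+1) => H.Adj p.1 p.2)).card = 2 * edgeCount H := by
    rw [← h2, e2]
  rw [h4, h1] at h3
  have : Q * (2 * edgeCount H) = 2 * (Q * edgeCount H) := by ring
  omega

end Lower

/-- Dou–Hu–Peng, Theorem 5: for even `k ≥ 4` and a 2-connected `F` with
`p(F) ≥ (k-2)/2 + 1`,
`ex(n, {𝓒_{≥k}, F}) = n·max{(k-2)/2, ex(k-1,F)/(k-2)} + O_k(1)`. -/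
theorem stmt3 {α : Type*} [Fintype α] (k : ℕ) (hk : 4 ≤ k) (hkeven : Even k)
    (F : SimpleGraph α) (hF2 : TwoConnected F) (hpF : PGE F ((k - 2) / 2 + 1)) :
    ∃ (C : ℝ) (N : ℕ), ∀ n : ℕ, N ≤ n →
      |(exMax n (fun G => ¬ HasCycleGE G k ∧ ¬ ContainsCopy F G) : ℝ)
        - (n : ℝ) * max (((k : ℝ) - 2) / 2)
            ((exMax (k - 1) (fun G => ¬ ContainsCopy F G) : ℝ) / ((k : ℝ) - 2))| ≤ C := by
  classical
  obtain ⟨s, hs⟩ := hkeven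
  obtain ⟨t, ht, hkt⟩ : ∃ t, 1 ≤ t ∧ k = 2 * t + 2 := ⟨s - 1, by omega, by omega⟩
  subst hkt
  have e1 : 2 * t + 2 - 1 = 2 * t + 1 := rfl
  have e2' : (2 * t + 2 - 2) / 2 = t := by omega
  rw [e2'] at hpF
  rw [e1]
  have ht' : (1 : ℝ) ≤ t := by exact_mod_cast ht
  -- the empty graph is F-free
  have hempty : ¬ ContainsCopy F (⊥ : SimpleGraph (Fin (2 * t + 1))) := by
    rintro ⟨f, hf, hfa⟩
    obtain ⟨a, b, hab⟩ : ∃ a b : α, a ≠ b := by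
      have := hF2.1
      have h1 : 1 < Fintype.card α := by omega
      obtain ⟨a, b, hab⟩ := Fintype.one_lt_card_iff.1 h1
      exact ⟨a, b, hab⟩
    exact hab (const_of_connected hF2.2.1 id (fun a b h => (hfa h).elim) a b)
  obtain ⟨H, hH, hHE⟩ := exMax_spec (P := fun G : SimpleGraph (Fin (2 * t + 1)) => ¬ ContainsCopy F G)
    ⟨⊥, hempty⟩
  generalize hE : exMax (2 * t + 1) (fun G => ¬ ContainsCopy F G) = E at hHE
  have c1 : (((2 * t + 2 : ℕ) : ℝ) - 2) / 2 = t := by push_cast; ring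
  have c2 : ((2 * t + 2 : ℕ) : ℝ) - 2 = 2 * t := by push_cast; ring
  rw [c1, c2]
  refine ⟨(t : ℝ) * t + 2 * E, 2 * t + 2, fun n hn => ?_⟩
  set M := max (t : ℝ) ((E : ℝ) / (2 * t)) with hM
  have hn' : (2 * t + 2 : ℝ) ≤ n := by exact_mod_cast hn
  have hE0 : (0 : ℝ) ≤ E := Nat.cast_nonneg E
  have hMt : (t : ℝ) ≤ M := le_max_left _ _
  have hME : (E : ℝ) ≤ M * (2 * t) := by
    have : (E : ℝ) / (2 * t) ≤ M := le_max_right _ _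
    rwa [div_le_iff₀ (by linarith)] at this
  set X := exMax n (fun G => ¬ HasCycleGE G (2 * t + 2) ∧ ¬ ContainsCopy F G) with hX
  have low1 : t * (n - t) ≤ X := (bip_edges n t (by omega)).trans
    (le_exMax (P := fun G => ¬ HasCycleGE G (2 * t + 2) ∧ ¬ ContainsCopy F G) (bip n t)
      ⟨bip_cycle n t (by omega), bip_copy F n t (by omega) hpF⟩)
  have low2 : ((n - 1) / (2 * t)) * E ≤ X := by
    rw [← hHE]
    exact (glue_edges (hq := by omega) (by omega)).trans
      (le_exMax (P := fun G => ¬ HasCycleGE G (2 * t + 2) ∧ ¬ ContainsCopy F G)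
        (glue (2 * t) (by omega) H n) ⟨glue_cycle, glue_copy hF2 hH⟩)
  have up : (X : ℝ) ≤ n * M := by
    obtain ⟨G, ⟨hG1, hG2⟩, hGX⟩ := exMax_spec
      (P := fun G : SimpleGraph (Fin n) => ¬ HasCycleGE G (2 * t + 2) ∧ ¬ ContainsCopy F G)
      ⟨bip n t, bip_cycle n t (by omega), bip_copy F n t (by omega) hpF⟩
    have h1 := upper G t ht M hMt hG1 (by
      intro S hS
      have h2 := e2_le_exMax F G hG2 S _ hS
      rw [hE] at h2
      have h3 : (e2 G S : ℝ) ≤ 2 * E := by exact_mod_cast h2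
      linarith) n Finset.univ (by simp) ⟨⟨0, by omega⟩, Finset.mem_univ _⟩
    rw [e2_univ, hGX, ← hX] at h1
    push_cast at h1
    linarith
  have l1 : (n : ℝ) * t - t * t ≤ X := by
    have : ((t * (n - t) : ℕ) : ℝ) ≤ X := by exact_mod_cast low1
    rw [Nat.cast_mul, Nat.cast_sub (by omega)] at this
    linarith
  have l2 : (n : ℝ) * (E / (2 * t)) - 2 * E ≤ X := by
    have h1 : (((n - 1) / (2 * t) * E : ℕ) : ℝ) ≤ X := by exact_mod_cast low2
    rw [Nat.cast_mul] at h1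
    have h2 : (n : ℝ) ≤ (((n - 1) / (2 * t) : ℕ) : ℝ) * (2 * t) + 2 * (2 * t) := by
      have h3 := Nat.div_add_mod (n - 1) (2 * t)
      have h4 := Nat.mod_lt (n - 1) (show 2 * t > 0 by omega)
      have h5 : n ≤ ((n - 1) / (2 * t)) * (2 * t) + 2 * (2 * t) := by
        rw [mul_comm ((n - 1) / (2 * t)) (2 * t)]; omega
      exact_mod_cast h5
    have h6 : (n : ℝ) / (2 * t) ≤ (((n - 1) / (2 * t) : ℕ) : ℝ) + 2 := by
      rw [div_le_iff₀ (by linarith)]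
      linarith
    have h7 : (n : ℝ) * (E / (2 * t)) = n / (2 * t) * E := by ring
    rw [h7]
    have := mul_le_mul_of_nonneg_right h6 hE0
    linarith
  rw [abs_le]
  constructor
  · rcases max_choice (t : ℝ) ((E : ℝ) / (2 * t)) with h | h
    · rw [hM, h]; linarith
    · rw [hM, h]; nlinarith
  · nlinarith
end

section
/- Let G be a 2-connected graph on n vertices and let C be a longest cycle of G of length c with 4 ≤ c ≤ n−1. Let A_{⌊c/2⌋} = {u ∈ V(G)∖V(C) : d_C(u) = ⌊c/2⌋}. Then e(G−C) + e(G−C, C) ≤ ⌊c/2⌋·|A_{⌊c/2⌋}| + (⌊c/2⌋ − 1/2)·(n − c − |A_{⌊c/2⌋}|), where e(G−C) is the number of edges of G with both endpoints outside V(C) and e(G−C,C) is the number of edges with exactly one endpoint on C. -/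
open SimpleGraph

set_option linter.unusedSectionVars false

/-- vertex `b` is reachable from `a` inside `F`. -/
inductive Rc {V : Type*} (G : SimpleGraph V) (F : Set V) (a : V) : V → Prop
  | refl : a ∈ F → Rc G F a a
  | step {b c : V} : Rc G F a b → G.Adj b c → c ∈ F → Rc G F a c

/-- there is a path from `a` to `b` of length `n` inside `F`. -/
inductive LP {V : Type*} (G : SimpleGraph V) : Set V → V → V → ℕ → Prop
  | nil {F : Set V} {a : V} : a ∈ F → LP G F a a 0
  | cons {F : Set V} {a b c : V} {n : ℕ} : a ∈ F → G.Adj a b → LP G (F \ {a}) b c n →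
      LP G F a c (n + 1)

section paths
variable {V : Type*} {G : SimpleGraph V}

lemma Rc.left {F : Set V} {a b : V} (h : Rc G F a b) : a ∈ F := by
  induction h with
  | refl h => exact h
  | step _ _ _ ih => exact ih

lemma Rc.right {F : Set V} {a b : V} (h : Rc G F a b) : b ∈ F := by
  cases h with
  | refl h => exact h
  | step _ _ h => exact h

lemma Rc.mono {F F' : Set V} {a b : V} (h : Rc G F a b) (hF : F ⊆ F') : Rc G F' a b := by
  induction h with
  | refl h => exact .refl (hF h)
  | step _ h1 h2 ih => exact .step ih h1 (hF h2)

lemma Rc.trans {F : Set V} {a b c : V} (h : Rc G F a b) (h' : Rc G F b c) : Rc G F a c := by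
  induction h' with
  | refl _ => exact h
  | step _ h1 h2 ih => exact .step ih h1 h2

lemma Rc.symm {F : Set V} {a b : V} (h : Rc G F a b) : Rc G F b a := by
  induction h with
  | refl h => exact .refl h
  | step h0 h1 h2 ih => exact (Rc.step (.refl h2) h1.symm h0.right).trans ih

lemma Rc.avoid {F : Set V} {a b : V} (h : Rc G F a b) (z : V) (hz : a ≠ z) :
    Rc G (F \ {z}) a b ∨ ∃ b', Rc G (F \ {z}) a b' ∧ G.Adj b' z := by
  induction h with
  | refl h => exact .inl (.refl ⟨h, hz⟩)
  | @step b c h0 h1 h2 ih =>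
    rcases ih with ih | ih
    · by_cases hc : c = z
      · subst hc; exact .inr ⟨_, ih, h1⟩
      · exact .inl (.step ih h1 ⟨h2, hc⟩)
    · exact .inr ih

lemma Rc.closed {F K : Set V} {a b : V} (h : Rc G F a b) (ha : a ∈ K)
    (hK : ∀ x ∈ K, ∀ y ∈ F, G.Adj x y → y ∈ K) : Rc G (F ∩ K) a b := by
  induction h with
  | refl h => exact .refl ⟨h, ha⟩
  | step h0 h1 h2 ih => exact .step ih h1 ⟨h2, hK _ ih.right.2 _ h2 h1⟩

/-- first exit from the complement of `C`. -/
lemma Rc.exit {F C : Set V} {a b : V} (h : Rc G F a b) (ha : a ∉ C) (hb : b ∈ C) :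
    ∃ b', Rc G (F \ C) a b' ∧ ∃ y ∈ C, y ∈ F ∧ G.Adj b' y := by
  have : Rc G (F \ C) a b ∨ ∃ b', Rc G (F \ C) a b' ∧ ∃ y ∈ C, y ∈ F ∧ G.Adj b' y := by
    clear hb
    induction h with
    | refl h => exact .inl (.refl ⟨h, ha⟩)
    | @step b c h0 h1 h2 ih =>
      rcases ih with ih | ih
      · by_cases hc : c ∈ C
        · exact .inr ⟨_, ih, _, hc, h2, h1⟩
        · exact .inl (.step ih h1 ⟨h2, hc⟩)
      · exact .inr ih
  rcases this with h | h
  · exact absurd hb h.right.2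
  · exact h

lemma LP.left {F : Set V} {a b : V} {n : ℕ} (h : LP G F a b n) : a ∈ F := by
  cases h <;> assumption

lemma LP.mono {F F' : Set V} {a b : V} {n : ℕ} (h : LP G F a b n) (hF : F ⊆ F') :
    LP G F' a b n := by
  induction h generalizing F' with
  | nil h => exact .nil (hF h)
  | cons h1 h2 _ ih => exact .cons (hF h1) h2 (ih (Set.sdiff_subset_sdiff_left hF))

lemma LP.split {F : Set V} {a b : V} {n : ℕ} (h : LP G F a b n) (x : V) :
    LP G (F \ {x}) a b n ∨ ∃ m, LP G F x b m := by
  induction h with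
  | @nil F a h =>
    by_cases hx : a = x
    · subst hx; exact .inr ⟨0, .nil h⟩
    · exact .inl (.nil ⟨h, hx⟩)
  | @cons F a b c n h1 h2 h3 ih =>
    by_cases hx : a = x
    · subst hx; exact .inr ⟨_, .cons h1 h2 h3⟩
    rcases ih with ih | ⟨m, ih⟩
    · refine .inl (.cons ⟨h1, hx⟩ h2 (ih.mono ?_))
      intro y; simp; tauto
    · exact .inr ⟨m, ih.mono Set.sdiff_subset⟩

lemma Rc.lp {F : Set V} {a b : V} (h : Rc G F a b) : ∃ n, LP G F a b n := by
  have h' := h.symm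
  clear h
  induction h' with
  | refl h => exact ⟨0, .nil h⟩
  | @step x c h0 h1 h2 ih =>
    obtain ⟨n, hn⟩ := ih
    rcases hn.split c with h | h
    · exact ⟨_, .cons h2 h1.symm h⟩
    · exact h

lemma LP.append {F F' : Set V} {a b c d : V} {n m : ℕ} (h : LP G F a b n) (hbc : G.Adj b c)
    (h' : LP G F' c d m) (hd : ∀ x ∈ F, x ∉ F') : LP G (F ∪ F') a d (n + 1 + m) := by
  induction h with
  | @nil F a h =>
    have : LP G (F ∪ F') a d (m + 1) := .cons (.inl h) hbc (h'.mono (by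
      intro y hy; refine ⟨.inr hy, ?_⟩
      rintro rfl; exact hd _ h hy))
    convert this using 1; omega
  | @cons F a b c n h1 h2 h3 ih =>
    have := ih hbc (fun x hx => hd x hx.1)
    have : LP G (F ∪ F') a d (n + 1 + m + 1) := .cons (.inl h1) h2 (this.mono (by
      rintro y (hy | hy)
      · exact ⟨.inl hy.1, hy.2⟩
      · refine ⟨.inr hy, ?_⟩
        rintro rfl; exact hd _ h1 hy))
    convert this using 1; omega

lemma LP.walk {F : Set V} {a b : V} {n : ℕ} (h : LP G F a b n) :
    ∃ p : G.Walk a b, p.IsPath ∧ p.length = n ∧ ∀ x ∈ p.support, x ∈ F := by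
  induction h with
  | nil h => exact ⟨.nil, by simp, rfl, by simpa using h⟩
  | @cons F a b c n h1 h2 h3 ih =>
    obtain ⟨p, hp, hl, hs⟩ := ih
    refine ⟨.cons h2 p, ?_, by simp [hl], ?_⟩
    · rw [Walk.cons_isPath_iff]
      exact ⟨hp, fun h => (hs _ h).2 rfl⟩
    · intro x hx
      simp at hx
      rcases hx with rfl | hx
      · exact h1
      · exact (hs _ hx).1

lemma LP.cycle {F : Set V} {a b : V} {n c : ℕ} (h : LP G F a b n) (hn : 2 ≤ n) (hab : G.Adj b a)
    (hl : ∀ (x : V) (w' : G.Walk x x), w'.IsCycle → w'.length ≤ c) : n + 1 ≤ c := by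
  obtain ⟨p, hp, hlen, -⟩ := h.walk
  have := hl _ (.cons hab p) (by
    rw [Walk.cons_isCycle_iff]
    refine ⟨hp, fun he => ?_⟩
    cases p with
    | nil => simp at he
    | cons hh q =>
      rw [Walk.edges_cons, List.mem_cons] at he
      rw [Walk.cons_isPath_iff] at hp
      rcases he with he | he
      · rw [Sym2.eq_iff] at he
        rcases he with ⟨h1, h2⟩ | ⟨h1, h2⟩
        · exact absurd h1 hab.ne
        · subst h1
          have := (Walk.isPath_iff_nil.1 hp.1).eq_nil
          subst this
          simp at hlen; omega
      · exact hp.2 (q.snd_mem_support_of_mem_edges he))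
  simp at this; omega

end paths

section counting
open Classical
variable {V : Type*} [Fintype V] (G : SimpleGraph V)

/-- size of a set -/
noncomputable def cn (S : Set V) : ℕ := ∑ x, if x ∈ S then 1 else 0

/-- twice the number of edges inside `F` -/
noncomputable def dg (F : Set V) : ℕ :=
  ∑ x, ∑ y, if x ∈ F ∧ y ∈ F ∧ G.Adj x y then 1 else 0

lemma cn_mono {S T : Set V} (h : S ⊆ T) : cn S ≤ cn T := by
  unfold cn
  refine Finset.sum_le_sum fun x _ => ?_
  have := @h x
  split_ifs <;> simp_all

lemma cn_split {S K : Set V} : cn S = cn (S ∩ K) + cn (S \ K) := by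
  unfold cn
  rw [← Finset.sum_add_distrib]
  refine Finset.sum_congr rfl fun x _ => ?_
  by_cases h1 : x ∈ S <;> by_cases h2 : x ∈ K <;> simp [h1, h2]

lemma cn_singleton (a : V) : cn ({a} : Set V) = 1 := by
  simp [cn]

lemma cn_erase {S : Set V} {a : V} (ha : a ∈ S) : cn S = cn (S \ {a}) + 1 := by
  rw [cn_split (K := {a}), Set.inter_eq_right.2 (by simpa using ha), cn_singleton]; omega

lemma cn_pos {S : Set V} {a : V} (ha : a ∈ S) : 1 ≤ cn S := by
  rw [cn_erase ha]; omega

lemma cn_eq_zero {S : Set V} (h : cn S = 0) (a : V) : a ∉ S := fun ha => by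
  have := cn_pos ha; omega

lemma dg_closed {F K : Set V} (hK : K ⊆ F) (hc : ∀ x ∈ K, ∀ y ∈ F, G.Adj x y → y ∈ K) :
    dg G F ≤ dg G K + dg G (F \ K) := by
  unfold dg
  simp only [← Finset.sum_add_distrib]
  refine Finset.sum_le_sum fun x _ => Finset.sum_le_sum fun y _ => ?_
  have h1 := @hK x
  have h2 := @hK y
  have h3 := hc x
  have h4 := hc y
  have h5 := G.adj_comm x y
  simp only [Set.mem_sdiff]
  grind

lemma dg_frag {F K : Set V} {z : V} (hK : K ⊆ F \ {z})
    (hc : ∀ x ∈ K, ∀ y ∈ F \ {z}, G.Adj x y → y ∈ K) :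
    dg G F ≤ dg G K + dg G (F \ K) + 2 * cn ({x | G.Adj x z} ∩ K) := by
  have e1 : cn ({x | G.Adj x z} ∩ K) = ∑ x, ∑ y, if x ∈ K ∧ y = z ∧ G.Adj x z then 1 else 0 := by
    unfold cn
    refine Finset.sum_congr rfl fun x _ => ?_
    by_cases h1 : x ∈ K <;> by_cases h2 : G.Adj x z <;> simp [h1, h2]
  have e2 : cn ({x | G.Adj x z} ∩ K) = ∑ x, ∑ y, if y ∈ K ∧ x = z ∧ G.Adj y z then 1 else 0 := by
    rw [e1, Finset.sum_comm]
  rw [two_mul]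
  nth_rewrite 1 [e1]
  rw [e2]
  unfold dg
  simp only [← Finset.sum_add_distrib]
  refine Finset.sum_le_sum fun x _ => Finset.sum_le_sum fun y _ => ?_
  have h1 := @hK x
  have h2 := @hK y
  have h3 := hc x
  have h4 := hc y
  have h5 := G.adj_comm x y
  simp only [Set.mem_sdiff, Set.mem_singleton_iff] at *
  grind

lemma dg_erase (F : Set V) (z : V) :
    dg G F ≤ dg G (F \ {z}) + 2 * cn ({x | G.Adj z x} ∩ (F \ {z})) := by
  have := dg_frag G (F := F) (K := F \ {z}) (z := z) subset_rfl (fun x _ y hy _ => hy)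
  have h0 : dg G (F \ (F \ {z})) = 0 := by
    unfold dg
    refine Finset.sum_eq_zero fun x _ => Finset.sum_eq_zero fun y _ => ?_
    rw [if_neg]
    rintro ⟨h1, h2, h3⟩
    have : x = y := by simp at h1 h2; grind
    exact h3.ne this
  have h1 : {x | G.Adj x z} = {x | G.Adj z x} := by ext x; simp [G.adj_comm]
  rw [h1] at this
  omega

lemma dg_indep {F : Set V} (h : ∀ x ∈ F, ∀ y ∈ F, ¬ G.Adj x y) : dg G F = 0 := by
  unfold dg
  refine Finset.sum_eq_zero fun x _ => Finset.sum_eq_zero fun y _ => ?_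
  rw [if_neg]
  rintro ⟨h1, h2, h3⟩
  exact h x h1 y h2 h3

/-- the rooted two-connectedness condition -/
structure Rt (F P Q : Set V) : Prop where
  hP : ∀ a ∈ F, ∃ b ∈ P, Rc G F a b
  hQ : ∀ a ∈ F, ∃ b ∈ Q, Rc G F a b
  hz : ∀ z ∈ F, ∀ a ∈ F, a ≠ z → ∃ b, (b ∈ P ∨ b ∈ Q) ∧ Rc G (F \ {z}) a b

variable {G}

lemma LP.zero {F : Set V} {a b : V} (h : LP G F a b 0) : a = b := by
  cases h; rfl

lemma Rt.indep {F P Q : Set V} (h : Rt G F P Q)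
    (hm : ∀ a ∈ P, ∀ b ∈ Q, ∀ n, LP G F a b n → n + 1 ≤ 1) : ∀ x ∈ F, ∀ y ∈ F, ¬ G.Adj x y := by
  have key : ∀ a ∈ P, ∀ b ∈ Q, Rc G F a b → a = b := by
    intro a ha b hb hab
    obtain ⟨n, hn⟩ := hab.lp
    have := hm a ha b hb n hn
    obtain rfl : n = 0 := by omega
    exact hn.zero
  have key2 : ∀ x ∈ F, ∀ r ∈ P, r ∈ Q → Rc G F x r → x = r := by
    intro x hx r hr hr' hxr
    by_contra hne
    obtain ⟨b, hb, hb'⟩ := h.hz r hxr.right x hx hne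
    have hbr := hb'.right.2
    have hb'' := (hb'.mono Set.sdiff_subset).symm.trans hxr
    rcases hb with hb | hb
    · exact hbr (key b hb r hr' hb'')
    · exact hbr (key r hr b hb hb''.symm).symm
  intro x hx y hy hxy
  obtain ⟨p, hp, hxp⟩ := h.hP x hx
  obtain ⟨q, hq, hxq⟩ := h.hQ x hx
  obtain rfl := key p hp q hq (hxp.symm.trans hxq)
  have h1 := key2 x hx p hp hq hxp
  have h2 := key2 y hy p hp hq ((Rc.step (.refl hx) hxy hy).symm.trans hxp)
  exact hxy.ne (h1.trans h2.symm)

/-- one peeling step -/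
lemma Rt.peel {F Q : Set V} {w : V} (hw : w ∈ F)
    (hcon : ∀ a ∈ F, ∀ b ∈ F, Rc G F a b)
    (hq : ∀ z ∈ F, ∀ a ∈ F, a ≠ z → ∃ b ∈ Q, Rc G (F \ {z}) a b) :
    Rt G (F \ {w}) {x | G.Adj w x} Q := by
  refine ⟨?_, ?_, ?_⟩
  · intro a ha
    rcases (hcon a ha.1 w hw).avoid w ha.2 with h | ⟨b, h, h'⟩
    · exact absurd rfl h.right.2
    · exact ⟨b, h'.symm, h⟩
  · intro a ha
    obtain ⟨b, hb, h⟩ := hq w hw a ha.1 ha.2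
    exact ⟨b, by tauto, h⟩
  · intro z hz a ha haz
    obtain ⟨b, hb, h⟩ := hq z hz.1 a ha.1 haz
    have e : (F \ {z}) \ {w} = (F \ {w}) \ {z} := by ext; simp; tauto
    rcases h.avoid w ha.2 with h | ⟨b', h, h'⟩
    · exact ⟨b, by tauto, e ▸ h⟩
    · exact ⟨b', .inl h'.symm, e ▸ h⟩

lemma Rt.split {F P Q : Set V} (h : Rt G F P Q) {K : Set V} (hK : K ⊆ F)
    (hc : ∀ x ∈ K, ∀ y ∈ F, G.Adj x y → y ∈ K) : Rt G K P Q := by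
  have e : F ∩ K = K := Set.inter_eq_right.2 hK
  refine ⟨?_, ?_, ?_⟩
  · intro a ha
    obtain ⟨b, hb, h'⟩ := h.hP a (hK ha)
    exact ⟨b, hb, e ▸ h'.closed ha hc⟩
  · intro a ha
    obtain ⟨b, hb, h'⟩ := h.hQ a (hK ha)
    exact ⟨b, hb, e ▸ h'.closed ha hc⟩
  · intro z hz a ha haz
    obtain ⟨b, hb, h'⟩ := h.hz z (hK hz) a (hK ha) haz
    refine ⟨b, hb, (h'.closed ha fun x hx y hy => hc x hx y hy.1).mono ?_⟩
    intro y hy; exact ⟨hy.2, hy.1.2⟩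

/-- The edge-counting lemma for rooted graphs. -/
lemma rooted_bound (N : ℕ) : ∀ (F P Q : Set V) (m : ℕ), cn F ≤ N → 2 ≤ m → Rt G F P Q →
    (∀ a ∈ P, ∀ b ∈ Q, ∀ n, LP G F a b n → n + 1 ≤ m) →
    dg G F + 2 * cn (P ∩ F) + 2 * cn (Q ∩ F) ≤ (2 * m + 1) * cn F := by
  induction N with
  | zero =>
    intro F P Q m hN _ _ _
    have h0 : cn F = 0 := by omega
    have h1 := cn_mono (Set.inter_subset_right : P ∩ F ⊆ F)
    have h2 := cn_mono (Set.inter_subset_right : Q ∩ F ⊆ F)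
    have h3 := dg_indep G (F := F) (fun x hx => absurd hx (cn_eq_zero h0 x))
    omega
  | succ N IH =>
    intro F P Q m hN hm hR hL
    have hPF := cn_mono (Set.inter_subset_right : P ∩ F ⊆ F)
    have hQF := cn_mono (Set.inter_subset_right : Q ∩ F ⊆ F)
    -- disconnected case
    by_cases hcon : ∀ a ∈ F, ∀ b ∈ F, Rc G F a b
    swap
    · push Not at hcon
      obtain ⟨a, ha, b, hb, hab⟩ := hcon
      set K : Set V := {x | Rc G F a x} with hKdef
      have hKF : K ⊆ F := fun x hx => Rc.right hx
      have hc : ∀ x ∈ K, ∀ y ∈ F, G.Adj x y → y ∈ K := fun x hx y hy hxy => Rc.step hx hxy hy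
      have hc' : ∀ x ∈ F \ K, ∀ y ∈ F, G.Adj x y → y ∈ F \ K := fun x hx y hy hxy =>
        ⟨hy, fun h => hx.2 (hc y h x hx.1 hxy.symm)⟩
      have haK : a ∈ K := Rc.refl ha
      have hsplit : cn F = cn K + cn (F \ K) := by
        rw [cn_split (S := F) (K := K), Set.inter_eq_right.2 hKF]
      have hsP : cn (P ∩ F) = cn (P ∩ K) + cn (P ∩ (F \ K)) := by
        rw [cn_split (S := P ∩ F) (K := K), Set.inter_assoc, Set.inter_eq_right.2 hKF,
          Set.inter_sdiff_assoc]
      have hsQ : cn (Q ∩ F) = cn (Q ∩ K) + cn (Q ∩ (F \ K)) := by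
        rw [cn_split (S := Q ∩ F) (K := K), Set.inter_assoc, Set.inter_eq_right.2 hKF,
          Set.inter_sdiff_assoc]
      have p1 := cn_pos haK
      have p2 := cn_pos (show b ∈ F \ K from ⟨hb, hab⟩)
      have i1 := IH K P Q m (by omega) hm (hR.split hKF hc)
        (fun a ha b hb n hn => hL a ha b hb n (hn.mono hKF))
      have i2 := IH (F \ K) P Q m (by omega) hm (hR.split Set.sdiff_subset hc')
        (fun a ha b hb n hn => hL a ha b hb n (hn.mono Set.sdiff_subset))
      have i3 := dg_closed G hKF hc
      rw [hsplit, mul_add]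
      omega
    -- fragment case
    by_cases hq : ∀ z ∈ F, ∀ a ∈ F, a ≠ z → ∃ b ∈ Q, Rc G (F \ {z}) a b
    swap
    · push Not at hq
      obtain ⟨z, hz, a, ha, haz, hab⟩ := hq
      set K : Set V := {x | Rc G (F \ {z}) a x} with hKdef
      have hKF' : K ⊆ F \ {z} := fun x hx => Rc.right hx
      have hKF : K ⊆ F := fun x hx => (hKF' hx).1
      have hc : ∀ x ∈ K, ∀ y ∈ F \ {z}, G.Adj x y → y ∈ K :=
        fun x hx y hy hxy => Rc.step hx hxy hy
      have hc' : ∀ x ∈ Kᶜ ∩ (F \ {z}), ∀ y ∈ F \ {z}, G.Adj x y → y ∈ Kᶜ ∩ (F \ {z}) :=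
        fun x hx y hy hxy => ⟨fun h => hx.1 (hc y h x hx.2 hxy.symm), hy⟩
      have haK : a ∈ K := Rc.refl ⟨ha, haz⟩
      have hKQ : ∀ x ∈ K, x ∉ Q := fun x hx hxQ => hab x hxQ hx
      have hzK : z ∉ K := fun h => (hKF' h).2 rfl
      -- the fragment is a rooted graph
      have R1 : Rt G K P {x | G.Adj z x} := by
        refine ⟨?_, ?_, ?_⟩
        · intro x hx
          obtain ⟨b, hb, h⟩ := hR.hz z hz x (hKF hx) (hKF' hx).2
          have h' := h.closed hx hc
          refine ⟨b, ?_, h'.mono Set.inter_subset_right⟩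
          rcases hb with hb | hb
          · exact hb
          · exact absurd hb (hKQ b h'.right.2)
        · intro x hx
          rcases (hcon x (hKF hx) z hz).avoid z (hKF' hx).2 with h | ⟨b, h, h'⟩
          · exact absurd rfl h.right.2
          · exact ⟨b, h'.symm, (h.closed hx hc).mono Set.inter_subset_right⟩
        · intro z' hz' x hx hxz
          obtain ⟨b, hb, h⟩ := hR.hz z' (hKF hz') x (hKF hx) hxz
          have hcc : ∀ x ∈ K, ∀ y ∈ (F \ {z'}) \ {z}, G.Adj x y → y ∈ K :=
            fun x hx y hy => hc x hx y ⟨hy.1.1, hy.2⟩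
          have hsub : ((F \ {z'}) \ {z}) ∩ K ⊆ K \ {z'} := fun y hy => ⟨hy.2, hy.1.1.2⟩
          rcases h.avoid z (hKF' hx).2 with h | ⟨b', h, h'⟩
          · have h1 := h.closed hx hcc
            refine ⟨b, .inl ?_, h1.mono hsub⟩
            rcases hb with hb | hb
            · exact hb
            · exact absurd hb (hKQ b h1.right.2)
          · exact ⟨b', .inr h'.symm, (h.closed hx hcc).mono hsub⟩
      -- z reaches Q outside K
      have zQ : ∃ b ∈ Q, Rc G (F \ K) z b := by
        obtain ⟨b, hb, h⟩ := hR.hQ z hz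
        by_cases hbz : b = z
        · subst hbz; exact ⟨b, hb, .refl ⟨hz, hzK⟩⟩
        have hbF : b ∈ Kᶜ ∩ (F \ {z}) := ⟨fun h => hKQ b h hb, h.right, hbz⟩
        rcases h.symm.avoid z hbz with h | ⟨b', h, h'⟩
        · exact absurd rfl h.right.2
        · have h1 := h.closed hbF hc'
          have h2 : Rc G (F \ K) b b' := h1.mono fun y hy => ⟨hy.1.1, hy.2.1⟩
          exact ⟨b, hb, (Rc.step h2 h' ⟨hz, hzK⟩).symm⟩
      -- the rest is a rooted graph
      have hstay : ∀ x ∈ F \ K, ∀ b, ∀ F' ⊆ F, Rc G F' x b → x ≠ z → z ∉ F' →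
          Rc G (F' \ K) x b := by
        intro x hx b F' hF' h hxz hzF'
        have hxx : x ∈ Kᶜ ∩ (F \ {z}) := ⟨hx.2, hx.1, hxz⟩
        refine (h.closed hxx fun u hu y hy => hc' u hu y ⟨hF' hy, ?_⟩).mono ?_
        · rintro rfl; exact hzF' hy
        · exact fun y hy => ⟨hy.1, hy.2.1⟩
      have xz : ∀ x ∈ F \ K, Rc G (F \ K) x z := by
        intro x hx
        by_cases hxz : x = z
        · subst hxz; exact .refl hx
        rcases (hcon x hx.1 z hz).avoid z hxz with h | ⟨b, h, h'⟩
        · exact absurd rfl h.right.2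
        · exact Rc.step ((hstay x hx b _ Set.sdiff_subset h hxz (by simp)).mono
            (Set.sdiff_subset_sdiff_left Set.sdiff_subset)) h' ⟨hz, hzK⟩
      have R2 : Rt G (F \ K) (P ∪ {z}) Q := by
        refine ⟨?_, ?_, ?_⟩
        · intro x hx
          exact ⟨z, .inr rfl, xz x hx⟩
        · intro x hx
          obtain ⟨b, hb, h⟩ := zQ
          exact ⟨b, hb, (xz x hx).trans h⟩
        · intro z' hz' x hx hxz'
          by_cases hxz : x = z
          · subst hxz
            exact ⟨x, .inl (.inr rfl), .refl ⟨hx, hxz'⟩⟩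
          obtain ⟨b, hb, h⟩ := hR.hz z' hz'.1 x hx.1 hxz'
          have hsub : ((F \ {z'}) \ {z}) \ K ⊆ (F \ K) \ {z'} :=
            fun y hy => ⟨⟨hy.1.1.1, hy.2⟩, hy.1.1.2⟩
          have hsub' : ((F \ {z'}) \ {z}) ⊆ F := fun y hy => hy.1.1
          by_cases hzz : z' = z
          · subst hzz
            refine ⟨b, ?_, (hstay x hx b _ Set.sdiff_subset h hxz (by simp)).mono ?_⟩
            · rcases hb with hb | hb
              · exact .inl (.inl hb)
              · exact .inr hb
            · exact fun y hy => ⟨⟨hy.1.1, hy.2⟩, hy.1.2⟩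
          rcases h.avoid z hxz with h | ⟨b', h, h'⟩
          · refine ⟨b, ?_, (hstay x hx b _ hsub' h hxz (by simp)).mono hsub⟩
            rcases hb with hb | hb
            · exact .inl (.inl hb)
            · exact .inr hb
          · exact ⟨z, .inl (.inr rfl), Rc.step ((hstay x hx b' _ hsub' h hxz (by simp)).mono hsub)
              h' ⟨⟨hz, hzK⟩, fun h => hzz h.symm⟩⟩
      have hsplit : cn F = cn K + cn (F \ K) := by
        rw [cn_split (S := F) (K := K), Set.inter_eq_right.2 hKF]
      have hsP : cn (P ∩ F) = cn (P ∩ K) + cn (P ∩ (F \ K)) := by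
        rw [cn_split (S := P ∩ F) (K := K), Set.inter_assoc, Set.inter_eq_right.2 hKF,
          Set.inter_sdiff_assoc]
      have hsQ : cn (Q ∩ F) ≤ cn (Q ∩ (F \ K)) := by
        refine cn_mono fun x hx => ⟨hx.1, hx.2, fun h => hKQ x h hx.1⟩
      have hsP' : cn (P ∩ (F \ K)) ≤ cn ((P ∪ {z}) ∩ (F \ K)) :=
        cn_mono fun x hx => ⟨.inl hx.1, hx.2⟩
      have p1 := cn_pos haK
      have p2 := cn_pos (show z ∈ F \ K from ⟨hz, hzK⟩)
      have hKu : K ∪ F \ K ⊆ F := by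
        rintro x (hx | hx)
        · exact hKF hx
        · exact hx.1
      have i1 := IH K P {x | G.Adj z x} m (by omega) hm R1 (by
        intro p hp q hq n hn
        obtain ⟨b, hb, h⟩ := zQ
        obtain ⟨n', hn'⟩ := h.lp
        have := hL p hp b hb _ ((hn.append (G.adj_symm hq) hn' (fun x hx hx' => hx'.2 hx)).mono hKu)
        omega)
      have i2 := IH (F \ K) (P ∪ {z}) Q m (by omega) hm R2 (by
        intro p hp q hq n hn
        rcases hp with hp | hp
        · exact hL p hp q hq n (hn.mono Set.sdiff_subset)
        · obtain rfl : p = z := hp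
          obtain ⟨b0, hb0, h0⟩ := R1.hP a haK
          obtain ⟨b1, hb1, h1⟩ := R1.hQ a haK
          obtain ⟨n', hn'⟩ := (h0.symm.trans h1).lp
          have := hL b0 hb0 q hq _ ((hn'.append (G.adj_symm hb1) hn
            (fun x hx hx' => hx'.2 hx)).mono hKu)
          omega)
      have i3 := dg_frag G hKF' hc
      have i4 : {x | G.Adj x z} = {x | G.Adj z x} := by ext x; simp [G.adj_comm]
      rw [i4] at i3
      rw [hsplit, mul_add]
      omega
    -- main case
    by_cases hne : ∃ a, a ∈ F
    swap
    · push Not at hne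
      have := dg_indep G (F := F) (fun x hx => absurd hx (hne x))
      have h0 : cn F = 0 := by simp [cn, hne]
      omega
    obtain ⟨a, ha⟩ := hne
    obtain ⟨w, hwP, haw⟩ := hR.hP a ha
    have hw : w ∈ F := haw.right
    have hpath : ∀ w ∈ P, w ∈ F → ∀ a ∈ {x | G.Adj w x}, ∀ b ∈ Q, ∀ n, LP G (F \ {w}) a b n →
        n + 1 + 1 ≤ m := by
      intro w hwP hw x hx b hb n hn
      exact hL w hwP b hb (n + 1) (.cons hw hx hn)
    have e1 := cn_erase hw
    have e2 := dg_erase G F w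
    have e3 : cn ({x | G.Adj w x} ∩ (F \ {w})) ≤ cn (F \ {w}) := cn_mono Set.inter_subset_right
    by_cases hm2 : m = 2
    · subst hm2
      have ind : ∀ w ∈ P, w ∈ F → ∀ x ∈ F \ {w}, ∀ y ∈ F \ {w}, ¬ G.Adj x y := by
        intro w hwP hw
        refine (Rt.peel hw hcon hq).indep ?_
        intro x hx b hb n hn
        have := hpath w hwP hw x hx b hb n hn
        omega
      have e4 := dg_indep G (ind w hwP hw)
      by_cases hP1 : ∃ w' ∈ P, w' ∈ F ∧ w' ≠ w
      · obtain ⟨w', hw'P, hw', hne⟩ := hP1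
        have hF : F ⊆ {w} ∪ {w'} := by
          intro x hx
          by_contra hxx
          simp only [Set.mem_union, Set.mem_singleton_iff, not_or] at hxx
          have h3 := hcon x hx w hw
          have : ∀ b, Rc G F x b → b = x := by
            intro b hb
            induction hb with
            | refl _ => rfl
            | @step b c h0 h1 h2 ih =>
              subst ih
              exfalso
              by_cases hcw : c = w
              · subst hcw
                exact ind w' hw'P hw' b ⟨hx, hxx.2⟩ c ⟨h2, hne.symm⟩ h1
              · exact ind w hwP hw b ⟨hx, hxx.1⟩ c ⟨h2, hcw⟩ h1
          exact hxx.1 (this w h3).symm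
        have e5 : cn (F \ {w}) ≤ 1 := by
          rw [← cn_singleton w']
          refine cn_mono fun x hx => ?_
          rcases hF hx.1 with h | h
          · exact absurd h hx.2
          · exact h
        have e6 := cn_pos (show w' ∈ F \ {w} from ⟨hw', hne⟩)
        omega
      · push Not at hP1
        have e5 : cn (P ∩ F) ≤ 1 := by
          rw [← cn_singleton w]
          exact cn_mono fun x hx => hP1 x hx.1 hx.2
        omega
    · have i1 := IH (F \ {w}) {x | G.Adj w x} Q (m - 1) (by omega) (by omega)
        (Rt.peel hw hcon hq) (fun x hx b hb n hn => by
          have := hpath w hwP hw x hx b hb n hn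
          omega)
      have e5 : cn (Q ∩ F) ≤ cn (Q ∩ (F \ {w})) + 1 := by
        rw [cn_split (S := Q ∩ F) (K := {w}), Set.inter_sdiff_assoc, add_comm]
        gcongr
        rw [← cn_singleton w]
        exact cn_mono Set.inter_subset_right
      obtain ⟨m', rfl⟩ : ∃ m', m = m' + 3 := ⟨m - 3, by omega⟩
      simp only [show m' + 3 - 1 = m' + 2 by omega] at i1
      rw [e1] at hPF ⊢
      nlinarith


lemma cn_eq_ncard (S : Set V) : cn S = S.ncard := by
  rw [Set.ncard_eq_toFinset_card', cn, Finset.sum_boole]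
  simp only [Nat.cast_id]
  congr 1
  ext x; simp

/-- a parametrised cycle -/
structure Cy (G : SimpleGraph V) {c : ℕ} (f : ZMod c → V) : Prop where
  inj : Function.Injective f
  adj : ∀ t, G.Adj (f t) (f (t + 1))

lemma Cy.shift {c : ℕ} {f : ZMod c → V} (h : Cy G f) (j : ZMod c) : Cy G (fun t => f (t + j)) := by
  refine ⟨fun a b hab => by simpa using h.inj hab, fun t => ?_⟩
  have := h.adj (t + j)
  rwa [show t + j + 1 = t + 1 + j by ring] at this

lemma Cy.neg {c : ℕ} {f : ZMod c → V} (h : Cy G f) : Cy G (fun t => f (-t)) := by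
  refine ⟨fun a b hab => by simpa using h.inj hab, fun t => ?_⟩
  have := (h.adj (-(t + 1))).symm
  rwa [show -(t + 1) + 1 = -t by ring] at this

lemma range_shift {c : ℕ} (f : ZMod c → V) (j : ZMod c) :
    Set.range (fun t => f (t + j)) = Set.range f := by
  ext x; constructor
  · rintro ⟨t, rfl⟩; exact ⟨_, rfl⟩
  · rintro ⟨t, rfl⟩; exact ⟨t - j, by simp⟩

lemma range_neg {c : ℕ} (f : ZMod c → V) :
    Set.range (fun t => f (-t)) = Set.range f := by
  ext x; constructor
  · rintro ⟨t, rfl⟩; exact ⟨_, rfl⟩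
  · rintro ⟨t, rfl⟩; exact ⟨-t, by simp⟩

lemma Cy.arc {c : ℕ} {f : ZMod c → V} (h : Cy G f) (i : ℕ) : ∀ a : ℕ, a + i < c →
    LP G {x | ∃ t : ℕ, a ≤ t ∧ t ≤ a + i ∧ x = f t} (f a) (f ((a + i : ℕ) : ZMod c)) i := by
  induction i with
  | zero => intro a _; exact .nil ⟨a, le_rfl, le_rfl, rfl⟩
  | succ i ih =>
    intro a ha
    have h1 := ih (a + 1) (by omega)
    rw [show a + 1 + i = a + (i + 1) by ring] at h1
    refine .cons ⟨a, le_rfl, by omega, rfl⟩ (by simpa using h.adj a) (h1.mono ?_)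
    rintro x ⟨t, h2, h3, rfl⟩
    refine ⟨⟨t, by omega, h3, rfl⟩, fun h4 => ?_⟩
    have h5 := h.inj h4
    rw [ZMod.natCast_eq_natCast_iff'] at h5
    rw [Nat.mod_eq_of_lt (by omega), Nat.mod_eq_of_lt (by omega)] at h5
    omega

lemma Cy.gap1 {c : ℕ} {f : ZMod c → V} (h : Cy G f)
    (hl : ∀ (x : V) (w' : G.Walk x x), w'.IsCycle → w'.length ≤ c)
    {u v : V} {L i : ℕ} (hp : LP G (Set.range f)ᶜ u v L) (hv : G.Adj v (f 0))
    (hu : G.Adj u (f (i : ZMod c))) (h0 : 0 < i) (hi : i < c) : L + i + 2 ≤ c := by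
  have h1 := h.arc i 0 (by omega)
  simp only [Nat.cast_zero, zero_add] at h1
  have h2 := hp.append hv h1 (by
    rintro x hx ⟨t, -, -, rfl⟩
    exact hx ⟨_, rfl⟩)
  have := h2.cycle (by omega) hu.symm hl
  omega

lemma Cy.gap2 {c : ℕ} {f : ZMod c → V} (h : Cy G f)
    (hl : ∀ (x : V) (w' : G.Walk x x), w'.IsCycle → w'.length ≤ c)
    {u v : V} {L i : ℕ} (hp : LP G (Set.range f)ᶜ u v L) (hv : G.Adj v (f 0))
    (hu : G.Adj u (f (i : ZMod c))) (h0 : 0 < i) (hi : i < c) : L + 2 ≤ i := by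
  have := h.neg.gap1 hl (u := u) (v := v) (L := L) (i := c - i) (by rwa [range_neg])
    (by simpa using hv) (by
      rw [Nat.cast_sub hi.le]; simpa using hu) (by omega) (by omega)
  omega

lemma Cy.gap3 {c : ℕ} {f : ZMod c → V} (h : Cy G f) (hc : 4 ≤ c)
    (hl : ∀ (x : V) (w' : G.Walk x x), w'.IsCycle → w'.length ≤ c)
    {u v x y : V} {L : ℕ} (hp : LP G (Set.range f)ᶜ u v L) (hx : x ∈ Set.range f)
    (hy : y ∈ Set.range f) (hxy : x ≠ y) (hv : G.Adj v y) (hu : G.Adj u x) :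
    L + 2 ≤ c / 2 := by
  have : NeZero c := ⟨by omega⟩
  obtain ⟨i, rfl⟩ := hx
  obtain ⟨j, rfl⟩ := hy
  have hs := h.shift j
  have hu' : G.Adj u (f (((i - j).val : ZMod c) + j)) := by simpa using hu
  have hv' : G.Adj v (f (0 + j)) := by simpa using hv
  have h0 : 0 < (i - j).val := by
    rw [Nat.pos_iff_ne_zero]
    intro h0
    rw [ZMod.val_eq_zero, sub_eq_zero] at h0
    exact hxy (by rw [h0])
  have hlt := ZMod.val_lt (i - j)
  have h1 := hs.gap1 hl (by rwa [range_shift]) hv' hu' h0 hlt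
  have h2 := hs.gap2 hl (by rwa [range_shift]) hv' hu' h0 hlt
  omega

lemma Cy.noncons {c : ℕ} {f : ZMod c → V} (h : Cy G f) (hc : 4 ≤ c)
    (hl : ∀ (x : V) (w' : G.Walk x x), w'.IsCycle → w'.length ≤ c)
    {u : V} (hu : u ∉ Set.range f) (t : ZMod c) (h1 : G.Adj u (f t)) (h2 : G.Adj u (f (t + 1))) :
    False := by
  have := (h.shift t).gap2 hl (u := u) (v := u) (L := 0) (i := 1)
    (.nil (by rwa [range_shift])) (by simpa using h1)
    (by simpa [add_comm] using h2) (by omega) (by omega)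
  omega

lemma Cy.gap4 {c : ℕ} {f : ZMod c → V} (h : Cy G f) (hc : 4 ≤ c)
    (hl : ∀ (x : V) (w' : G.Walk x x), w'.IsCycle → w'.length ≤ c)
    {u v y : V} {L : ℕ} (hp : LP G (Set.range f)ᶜ u v L)
    (hy : y ∈ Set.range f) (hv : G.Adj v y) (hd : 2 ≤ cn ({x | G.Adj u x} ∩ Set.range f)) :
    L + cn ({x | G.Adj u x} ∩ Set.range f) ≤ c / 2 := by
  have : NeZero c := ⟨by omega⟩
  obtain ⟨j, rfl⟩ := hy
  have hs := h.shift j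
  rw [← range_shift f j] at hd hp ⊢
  have hv : G.Adj v ((fun t => f (t + j)) 0) := by simpa using hv
  generalize (fun t => f (t + j)) = g at *
  clear h
  have hu := hp.left
  set I := (Finset.Icc (L + 2) (c - L - 2)).filter (fun i : ℕ => G.Adj u (g (i : ZMod c))) with hI
  have hsub : {x | G.Adj u x} ∩ Set.range g ⊆ ↑(insert (g 0) (I.image fun i : ℕ => g (i : ZMod c))) := by
    rintro x ⟨hx, ⟨t, rfl⟩⟩
    rw [Finset.mem_coe, Finset.mem_insert, Finset.mem_image]
    by_cases ht : t = 0
    · left; rw [ht]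
    · right
      have ht0 : 0 < t.val := by
        rw [Nat.pos_iff_ne_zero]
        intro h0
        exact ht ((ZMod.val_eq_zero t).1 h0)
      have hlt := ZMod.val_lt t
      have hux : G.Adj u (g (t.val : ZMod c)) := by simpa using hx
      have h1 := hs.gap1 hl hp hv hux ht0 hlt
      have h2 := hs.gap2 hl hp hv hux ht0 hlt
      refine ⟨t.val, ?_, by simp⟩
      rw [hI, Finset.mem_filter, Finset.mem_Icc]
      exact ⟨⟨by omega, by omega⟩, hux⟩
  have hcard : cn ({x | G.Adj u x} ∩ Set.range g) ≤ I.card + 1 := by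
    rw [cn_eq_ncard]
    refine (Set.ncard_le_ncard hsub (Finset.finite_toSet _)).trans ?_
    rw [Set.ncard_coe_finset]
    refine (Finset.card_insert_le _ _).trans ?_
    gcongr
    exact Finset.card_image_le
  have hne : I.Nonempty := by
    rw [← Finset.card_pos]; omega
  obtain ⟨i0, hi0⟩ := hne
  rw [hI, Finset.mem_filter, Finset.mem_Icc] at hi0
  have hI2 : I.card ≤ ((Finset.range ((c - 2 * L - 4) / 2 + 1))).card := by
    refine Finset.card_le_card_of_injOn (fun i => (i - L - 2) / 2) ?_ ?_
    · intro i hi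
      rw [Finset.mem_coe, hI, Finset.mem_filter, Finset.mem_Icc] at hi
      simp only [Finset.coe_range, Set.mem_Iio]
      omega
    · have key : ∀ i ∈ I, ∀ i' ∈ I, (i - L - 2) / 2 = (i' - L - 2) / 2 → ¬ i < i' := by
        intro i hi i' hi' he hlt
        rw [hI, Finset.mem_filter, Finset.mem_Icc] at hi hi'
        obtain rfl : i' = i + 1 := by omega
        exact hs.noncons hc hl hu i hi.2 (by simpa using hi'.2)
      intro i hi i' hi' he
      have h1 := key i hi i' hi' he
      have h2 := key i' hi' i hi he.symm
      omega
  rw [Finset.card_range] at hI2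
  omega


/-- number of neighbours in `T` -/
noncomputable def dc (G : SimpleGraph V) (T : Set V) (u : V) : ℕ := cn ({x | G.Adj u x} ∩ T)

/-- number of edges between `H` and `T` -/
noncomputable def xc (G : SimpleGraph V) (T H : Set V) : ℕ := ∑ x, if x ∈ H then dc G T x else 0

lemma dc_pos {T : Set V} {u y : V} (hy : y ∈ T) (h : G.Adj u y) : 1 ≤ dc G T u :=
  cn_pos (a := y) ⟨h, hy⟩

lemma exists_of_dc {T : Set V} {u : V} (h : dc G T u ≠ 0) : ∃ y ∈ T, G.Adj u y := by
  by_contra hh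
  push Not at hh
  apply h
  unfold dc cn
  refine Finset.sum_eq_zero fun x _ => ?_
  rw [if_neg]
  rintro ⟨h1, h2⟩
  exact hh x h2 h1

lemma xc_split {T S K : Set V} (hK : K ⊆ S) : xc G T S = xc G T K + xc G T (S \ K) := by
  unfold xc
  rw [← Finset.sum_add_distrib]
  refine Finset.sum_congr rfl fun x _ => ?_
  have := @hK x
  by_cases h1 : x ∈ S <;> by_cases h2 : x ∈ K <;> simp_all

lemma xc_singleton {T : Set V} (u : V) : xc G T {u} = dc G T u := by
  simp [xc]

lemma xc_le {T H S : Set V} {s : ℕ} (h : ∀ x ∈ H, x ∈ S → dc G T x ≤ s)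
    (h0 : ∀ x ∈ H, x ∉ S → dc G T x = 0) : xc G T H ≤ s * cn (S ∩ H) := by
  unfold xc cn
  rw [Finset.mul_sum]
  refine Finset.sum_le_sum fun x _ => ?_
  by_cases h1 : x ∈ H <;> by_cases h2 : x ∈ S <;> simp [h1, h2, h0, h]

lemma comp_bound {c : ℕ} {f : ZMod c → V} (h : Cy G f) (hc : 4 ≤ c)
    (hl : ∀ (x : V) (w' : G.Walk x x), w'.IsCycle → w'.length ≤ c)
    {H : Set V} (hH : H ⊆ (Set.range f)ᶜ) (hcon : ∀ a ∈ H, ∀ b ∈ H, Rc G H a b)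
    (T1 : ∀ z ∈ H, ∀ a ∈ H, a ≠ z → ∃ b ∈ {b | ∃ y ∈ Set.range f, G.Adj b y}, Rc G (H \ {z}) a b)
    (T2 : ∀ x ∈ Set.range f, ∀ a ∈ H, ∃ b ∈ {b | ∃ y ∈ Set.range f, y ≠ x ∧ G.Adj b y}, Rc G H a b)
    (h2 : 2 ≤ cn H) :
    dg G H + 2 * xc G (Set.range f) H + cn H ≤ 2 * (c / 2) * cn H := by
  set T := Set.range f with hT
  set k := c / 2 with hk
  obtain ⟨a0, ha0⟩ : ∃ a, a ∈ H := by
    by_contra hh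
    push Not at hh
    have : cn H = 0 := by simp [cn, hh]
    omega
  -- connected sets with two elements have an edge
  have hedge : ¬ ∀ x ∈ H, ∀ y ∈ H, ¬ G.Adj x y := by
    intro hi
    have hsub : H ⊆ {a0} := by
      intro x hx
      have hr := hcon a0 ha0 x hx
      cases hr with
      | refl _ => rfl
      | step h1 h2 h3 => exact absurd h2 (hi _ h1.right _ h3)
    have := cn_mono hsub
    rw [cn_singleton] at this
    omega
  by_cases hs : ∀ u ∈ H, dc G T u ≤ 1
  · -- every vertex has at most one neighbour on the cycle
    obtain ⟨b, ⟨x, hx, hxb⟩, hb⟩ : ∃ b ∈ {b | ∃ y ∈ T, G.Adj b y}, Rc G H a0 b := by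
      obtain ⟨b, ⟨y, hy, -, hby⟩, hb⟩ := T2 (f 0) ⟨0, rfl⟩ a0 ha0
      exact ⟨b, ⟨y, hy, hby⟩, hb⟩
    set P : Set V := {u | G.Adj u x} with hP
    set Q : Set V := {b | ∃ y ∈ T, y ≠ x ∧ G.Adj b y} with hQ
    have R : Rt G H P Q := by
      refine ⟨fun a ha => ⟨b, hxb, hcon a ha b hb.right⟩, T2 x hx, ?_⟩
      intro z hz a ha haz
      obtain ⟨b, ⟨y, hy, hby⟩, hb⟩ := T1 z hz a ha haz
      refine ⟨b, ?_, hb⟩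
      by_cases hyx : y = x
      · subst hyx; exact .inl hby
      · exact .inr ⟨y, hy, hyx, hby⟩
    have hL : ∀ a ∈ P, ∀ b ∈ Q, ∀ n, LP G H a b n → n + 1 ≤ k - 1 := by
      rintro a ha b ⟨y, hy, hyx, hby⟩ n hn
      have := h.gap3 hc hl (hn.mono hH) hx hy hyx.symm hby ha
      omega
    have hk2 : 2 ≤ k := by omega
    by_cases hk3 : k = 2
    · rw [hk3] at hL
      exact absurd (R.indep hL) hedge
    have hW := rooted_bound (cn H) H P Q (k - 1) le_rfl (by omega) R hL
    have hX : xc G T H ≤ cn (P ∩ H) + cn (Q ∩ H) := by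
      unfold xc
      rw [cn, cn, ← Finset.sum_add_distrib]
      refine Finset.sum_le_sum fun u _ => ?_
      by_cases hu : u ∈ H
      · have h1 := hs u hu
        by_cases h0 : dc G T u = 0
        · simp [hu, h0]
        · obtain ⟨y, hy, huy⟩ := exists_of_dc h0
          by_cases hyx : y = x
          · have : u ∈ P := by rw [hyx] at huy; exact huy
            simp only [hu, if_true, Set.mem_inter_iff, this, and_self]
            omega
          · have : u ∈ Q := ⟨y, hy, hyx, huy⟩
            simp only [hu, if_true, Set.mem_inter_iff, this, and_self]
            omega
      · simp [hu]
    obtain ⟨k', hk'⟩ : ∃ k', k = k' + 1 := ⟨k - 1, by omega⟩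
    rw [hk'] at hW ⊢
    simp only [Nat.add_sub_cancel] at hW
    nlinarith
  -- a vertex with the largest number of neighbours
  push Not at hs
  obtain ⟨u1, hu1, hu1'⟩ := hs
  obtain ⟨u, hu, hmax⟩ := Set.exists_max_image H (dc G T) (Set.toFinite _) ⟨u1, hu1⟩
  have hs2 : 2 ≤ dc G T u := Nat.lt_of_lt_of_le hu1' (hmax u1 hu1)
  set s := dc G T u with hsdef
  set E : Set V := {b | ∃ y ∈ T, G.Adj b y} with hE
  have Rall : ∀ u ∈ H, Rt G (H \ {u}) {x | G.Adj u x} E := fun u hu => Rt.peel hu hcon T1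
  have hLall : ∀ u ∈ H, dc G T u = s → ∀ a ∈ {x | G.Adj u x}, ∀ b ∈ E, ∀ n,
      LP G (H \ {u}) a b n → n + 1 ≤ k - s := by
    rintro u hu hus a ha b ⟨y, hy, hby⟩ n hn
    have hp : LP G H u b (n + 1) := .cons hu ha hn
    have := h.gap4 hc hl (hp.mono hH) hy hby (by change 2 ≤ dc G T u; omega)
    change _ + dc G T u ≤ _ at this
    omega
  have e1 := cn_erase hu
  obtain ⟨b, hb⟩ : ∃ b, b ∈ H \ {u} := by
    by_contra hh
    push Not at hh
    have : cn (H \ {u}) = 0 := by unfold cn; exact Finset.sum_eq_zero fun x _ => if_neg (hh x)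
    omega
  have hsk : 1 ≤ k - s := by
    obtain ⟨p, hp, hbp⟩ := (Rall u hu).hP b hb
    obtain ⟨q, hq, hbq⟩ := (Rall u hu).hQ b hb
    obtain ⟨n, hn⟩ := (hbp.symm.trans hbq).lp
    have := hLall u hu rfl p hp q hq n hn
    omega
  have e2 := dg_erase G H u
  have e3 : xc G T H = s + xc G T (H \ {u}) := by
    rw [xc_split (K := {u}) (by simpa using hu), xc_singleton]
  have e4 : cn (E ∩ (H \ {u})) ≤ cn (H \ {u}) := cn_mono Set.inter_subset_right
  have e5 : cn ({x | G.Adj u x} ∩ (H \ {u})) ≤ cn (H \ {u}) := cn_mono Set.inter_subset_right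
  have hEz : ∀ x ∈ H \ {u}, x ∉ E → dc G T x = 0 := by
    intro x _ hxE
    by_contra h0
    exact hxE (exists_of_dc h0)
  by_cases hks : k - s = 1
  · have hind : ∀ u ∈ H, dc G T u = s → ∀ x ∈ H \ {u}, ∀ y ∈ H \ {u}, ¬ G.Adj x y := by
      intro u hu hus
      have := hLall u hu hus
      rw [hks] at this
      exact (Rall u hu).indep this
    have e6 := dg_indep G (hind u hu rfl)
    have hksum : k = s + 1 := by omega
    by_cases h3 : cn H = 2
    · have e7 : xc G T (H \ {u}) ≤ s * cn (E ∩ (H \ {u})) :=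
        xc_le (fun x hx _ => hmax x hx.1) hEz
      have e8 : cn (E ∩ (H \ {u})) ≤ 1 := by omega
      have e9 : s * cn (E ∩ (H \ {u})) ≤ s * 1 := Nat.mul_le_mul_left _ e8
      rw [hksum, h3]
      omega
    · have hlt : ∀ v ∈ H \ {u}, dc G T v ≤ s - 1 := by
        intro v hv
        by_contra hh
        have hvs : dc G T v = s := by
          have := hmax v hv.1
          omega
        have i1 := hind u hu rfl
        have i2 := hind v hv.1 hvs
        have : H ⊆ {u} ∪ {v} := by
          intro x hx
          by_contra hxx
          simp only [Set.mem_union, Set.mem_singleton_iff, not_or] at hxx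
          have : ∀ b, Rc G H x b → b = x := by
            intro b hb
            induction hb with
            | refl _ => rfl
            | @step b c h0 h1 h2 ih =>
              subst ih
              exfalso
              by_cases hcw : c = u
              · subst hcw
                exact i2 b ⟨hx, hxx.2⟩ c ⟨h2, fun h => hv.2 h.symm⟩ h1
              · exact i1 b ⟨hx, hxx.1⟩ c ⟨h2, hcw⟩ h1
          exact hxx.1 (this u (hcon x hx u hu)).symm
        have e7 : cn (H \ {u}) ≤ 1 := by
          rw [← cn_singleton v]
          refine cn_mono fun x hx => ?_
          rcases this hx.1 with h | h
          · exact absurd h hx.2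
          · exact h
        omega
      have e7 : xc G T (H \ {u}) ≤ (s - 1) * cn (E ∩ (H \ {u})) :=
        xc_le (fun x hx _ => hlt x hx) hEz
      have e8 := Nat.mul_le_mul_left (s - 1) e4
      obtain ⟨s', hs'⟩ : ∃ s', s = s' + 1 := ⟨s - 1, by omega⟩
      rw [hksum, e1, hs']
      rw [hs', Nat.add_sub_cancel] at e7 e8
      rw [hs'] at e3
      nlinarith
  · have hW := rooted_bound (cn (H \ {u})) (H \ {u}) {x | G.Adj u x} E (k - s) le_rfl (by omega)
      (Rall u hu) (hLall u hu rfl)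
    have e7 : xc G T (H \ {u}) ≤ s * cn (E ∩ (H \ {u})) :=
      xc_le (fun x hx _ => hmax x hx.1) hEz
    obtain ⟨m, hm⟩ : ∃ m, k = s + m := ⟨k - s, by omega⟩
    obtain ⟨s', hs'⟩ : ∃ s', s = s' + 1 := ⟨s - 1, by omega⟩
    have e8 := Nat.mul_le_mul_left s' e4
    have hm' : k - s = m := by omega
    rw [hm'] at hW
    rw [hm, e1]
    have hs1 : s * cn (E ∩ (H \ {u})) = s' * cn (E ∩ (H \ {u})) + cn (E ∩ (H \ {u})) := by
      rw [hs']; ring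
    have hs3 : s * cn (H \ {u}) = s' * cn (H \ {u}) + cn (H \ {u}) := by
      rw [hs']; ring
    have hs4 : 2 * (s + m) * (cn (H \ {u}) + 1) =
      2 * (s * cn (H \ {u})) + 2 * (m * cn (H \ {u})) + 2 * s + 2 * m := by ring
    have hs5 : (2 * m + 1) * cn (H \ {u}) = 2 * (m * cn (H \ {u})) + cn (H \ {u}) := by ring
    omega


lemma total_bound {c : ℕ} {f : ZMod c → V} (h : Cy G f) (hc : 4 ≤ c)
    (hl : ∀ (x : V) (w' : G.Walk x x), w'.IsCycle → w'.length ≤ c)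
    (S1 : ∀ z ∉ Set.range f, ∀ a ∉ Set.range f, a ≠ z →
      ∃ b ∈ {b | ∃ y ∈ Set.range f, G.Adj b y}, Rc G ((Set.range f)ᶜ \ {z}) a b)
    (S2 : ∀ x ∈ Set.range f, ∀ a ∉ Set.range f,
      ∃ b ∈ {b | ∃ y ∈ Set.range f, y ≠ x ∧ G.Adj b y}, Rc G (Set.range f)ᶜ a b) (N : ℕ) :
    ∀ U : Set V, cn U ≤ N → U ⊆ (Set.range f)ᶜ →
      (∀ x ∈ U, ∀ y ∈ (Set.range f)ᶜ, G.Adj x y → y ∈ U) →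
      dg G U + 2 * xc G (Set.range f) U + cn U ≤
        2 * (c / 2) * cn U + cn ({u | dc G (Set.range f) u = c / 2} ∩ U) := by
  set T := Set.range f with hT
  induction N with
  | zero =>
    intro U hN _ _
    have h0 : cn U = 0 := by omega
    have h3 := dg_indep G (F := U) (fun x hx => absurd hx (cn_eq_zero h0 x))
    have h4 : xc G T U = 0 := by simp [xc, cn_eq_zero h0]
    simp [h0, h3, h4]
  | succ N IH =>
    intro U hN hU hcl
    by_cases hne : ∃ a, a ∈ U
    swap
    · push Not at hne
      have h0 : cn U = 0 := by simp [cn, hne]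
      exact IH U (by omega) hU hcl
    obtain ⟨a, ha⟩ := hne
    set H : Set V := {x | Rc G Tᶜ a x} with hHdef
    have hHO : H ⊆ Tᶜ := fun x hx => Rc.right hx
    have hHc : ∀ x ∈ H, ∀ y ∈ Tᶜ, G.Adj x y → y ∈ H := fun x hx y hy hxy => Rc.step hx hxy hy
    have hHU : H ⊆ U := fun x hx => (Rc.closed hx ha hcl).right.2
    have haH : a ∈ H := Rc.refl (hU ha)
    have e1 : cn U = cn H + cn (U \ H) := by
      rw [cn_split (S := U) (K := H), Set.inter_eq_right.2 hHU]
    have e2 := xc_split (G := G) (T := T) hHU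
    have e3 := dg_closed G hHU (fun x hx y hy => hHc x hx y (hU hy))
    have e4 : cn ({u | dc G T u = c / 2} ∩ U) = cn ({u | dc G T u = c / 2} ∩ H) +
        cn ({u | dc G T u = c / 2} ∩ (U \ H)) := by
      rw [cn_split (S := {u | dc G T u = c / 2} ∩ U) (K := H), Set.inter_assoc,
        Set.inter_eq_right.2 hHU, Set.inter_sdiff_assoc]
    have p1 := cn_pos haH
    have i1 := IH (U \ H) (by omega) (fun x hx => hU hx.1) (fun x hx y hy hxy =>
      ⟨hcl x hx.1 y hy hxy, fun h => hx.2 (hHc y h x (hU hx.1) hxy.symm)⟩)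
    have i2 : dg G H + 2 * xc G T H + cn H ≤
        2 * (c / 2) * cn H + cn ({u | dc G T u = c / 2} ∩ H) := by
      by_cases h2 : 2 ≤ cn H
      · have := comp_bound h hc hl hHO
          (fun x hx y hy => by
            have h1 : Rc G Tᶜ x y := (Rc.symm hx).trans hy
            exact (h1.closed hx hHc).mono Set.inter_subset_right)
          (fun z hz x hx hxz => by
            obtain ⟨b, hb, hr⟩ := S1 z (hHO hz) x (hHO hx) hxz
            exact ⟨b, hb, (hr.closed hx fun u hu y hy => hHc u hu y hy.1).mono
              fun y hy => ⟨hy.2, hy.1.2⟩⟩)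
          (fun z hz x hx => by
            obtain ⟨b, hb, hr⟩ := S2 z hz x (hHO hx)
            exact ⟨b, hb, (hr.closed hx hHc).mono Set.inter_subset_right⟩) h2
        rw [← hT] at this
        omega
      · have h1 : cn H = 1 := by omega
        have hsub : ∀ x ∈ H, x = a := by
          intro x hx
          by_contra hxa
          have := cn_erase haH
          have := cn_pos (show x ∈ H \ {a} from ⟨hx, hxa⟩)
          omega
        have hHa : H = {a} := by
          ext x
          exact ⟨hsub x, fun h => by rw [Set.mem_singleton_iff.1 h]; exact haH⟩
        have hd0 : dg G H = 0 := dg_indep G (fun x hx y hy hxy =>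
          hxy.ne ((hsub x hx).trans (hsub y hy).symm))
        have hx0 : xc G T H = dc G T a := by rw [hHa, xc_singleton]
        have hle : dc G T a ≤ c / 2 := by
          by_cases hd2 : 2 ≤ dc G T a
          · obtain ⟨y, hy, hay⟩ := exists_of_dc (G := G) (T := T) (u := a) (by omega)
            have := h.gap4 hc hl (L := 0) (.nil (hU ha)) hy hay hd2
            change 0 + dc G T a ≤ _ at this
            omega
          · omega
        rw [hd0, hx0, h1]
        by_cases hdk : dc G T a = c / 2
        · have := cn_pos (show a ∈ {u | dc G T u = c / 2} ∩ H from ⟨hdk, haH⟩)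
          omega
        · omega
    rw [e1, mul_add]
    omega

lemma rc_of_walk {S : Set V} {a b : S} (p : (G.induce S).Walk a b) : Rc G S a b := by
  induction p with
  | nil => exact .refl (Subtype.prop _)
  | @cons u v w h p ih =>
    exact (Rc.step (.refl u.2) h v.2).trans ih

lemma exists_cy {v : V} (w : G.Walk v v) (hw : w.IsCycle) :
    ∃ f : ZMod w.length → V, Cy G f ∧ Set.range f = {x | x ∈ w.support} := by
  have h3 := hw.three_le_length
  have : NeZero w.length := ⟨by omega⟩
  have : Fact (1 < w.length) := ⟨by omega⟩
  refine ⟨fun t => w.getVert t.val, ⟨?_, ?_⟩, ?_⟩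
  · intro a b hab
    have ha := ZMod.val_lt a
    have hb := ZMod.val_lt b
    exact ZMod.val_injective _ (hw.getVert_injOn' (by simp; omega) (by simp; omega) hab)
  · intro t
    have ht := ZMod.val_lt t
    have h1 := w.adj_getVert_succ ht
    simp only [ZMod.val_add, ZMod.val_one]
    by_cases hlast : t.val + 1 = w.length
    · rw [hlast] at h1 ⊢
      rw [Nat.mod_self]
      simpa using h1
    · rw [Nat.mod_eq_of_lt (by omega)]
      exact h1
  · ext x
    simp only [Set.mem_range, Set.mem_setOf_eq, Walk.mem_support_iff_exists_getVert]
    constructor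
    · rintro ⟨t, rfl⟩
      exact ⟨t.val, rfl, (ZMod.val_lt t).le⟩
    · rintro ⟨n, rfl, hn⟩
      by_cases hlast : n = w.length
      · exact ⟨0, by simp [hlast]⟩
      · exact ⟨(n : ZMod w.length), by rw [ZMod.val_natCast_of_lt (by omega)]⟩

lemma edgesOutside_eq (T : Set V) : 2 * edgesOutside G T = dg G Tᶜ := by
  let G' : SimpleGraph V :=
    { Adj := fun x y => x ∈ Tᶜ ∧ y ∈ Tᶜ ∧ G.Adj x y
      symm := ⟨fun x y h => ⟨h.2.1, h.1, h.2.2.symm⟩⟩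
      loopless := ⟨fun x h => h.2.2.ne rfl⟩ }
  have h1 : {e ∈ G.edgeSet | ∀ x ∈ e, x ∉ T} = G'.edgeSet := by
    ext e
    induction e with
    | h x y =>
      simp only [Set.mem_setOf_eq, mem_edgeSet, Sym2.mem_iff, forall_eq_or_imp, forall_eq]
      change _ ↔ x ∈ Tᶜ ∧ y ∈ Tᶜ ∧ G.Adj x y
      simp only [Set.mem_compl_iff]
      tauto
  unfold edgesOutside
  rw [h1, ← coe_edgeFinset, Set.ncard_coe_finset, ← sum_degrees_eq_twice_card_edges]
  unfold dg
  refine Finset.sum_congr rfl fun x _ => ?_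
  have h2 : G'.neighborFinset x =
      Finset.univ.filter (fun y => x ∈ Tᶜ ∧ y ∈ Tᶜ ∧ G.Adj x y) := by
    ext y
    simp [G']
  rw [← card_neighborFinset_eq_degree, h2, Finset.card_filter]
  exact Finset.sum_congr rfl fun y _ => by congr

lemma edgesCross_le (T : Set V) : edgesCross G T ≤ xc G T Tᶜ := by
  have h1 : {e ∈ G.edgeSet | ∃ a b, e = s(a, b) ∧ a ∈ T ∧ b ∉ T} ⊆
      (fun p : V × V => s(p.1, p.2)) '' {p | p.1 ∈ Tᶜ ∧ p.2 ∈ T ∧ G.Adj p.1 p.2} := by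
    rintro e ⟨he, a, b, rfl, ha, hb⟩
    exact ⟨(b, a), ⟨hb, ha, G.adj_symm he⟩, Sym2.eq_swap⟩
  unfold edgesCross
  refine (Set.ncard_le_ncard h1 (Set.toFinite _)).trans ((Set.ncard_image_le (Set.toFinite _)).trans ?_)
  rw [← cn_eq_ncard, cn, Fintype.sum_prod_type]
  unfold xc dc cn
  refine Finset.sum_le_sum fun x _ => ?_
  by_cases hx : x ∈ T
  · simp [hx]
  · simp only [Set.mem_compl_iff, Set.mem_setOf_eq, hx, not_false_eq_true, true_and, if_true,
      Set.mem_inter_iff]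
    refine Finset.sum_le_sum fun y _ => ?_
    by_cases h1 : y ∈ T <;> by_cases h2 : G.Adj x y <;> simp [h1, h2]

lemma degOn_eq (T : Set V) (u : V) : degOn G T u = dc G T u := by
  unfold degOn dc
  rw [cn_eq_ncard]
  congr 1
  ext x; simp [and_comm]

end counting

/-- Strengthened Bondy-type lemma: for a longest cycle `C` of length `c`
(`4 ≤ c ≤ n−1`) in a 2-connected graph `G`,
`e(G−C) + e(G−C, C) ≤ ⌊c/2⌋·|A| + (⌊c/2⌋ − 1/2)·(n − c − |A|)`,
where `A = A_{⌊c/2⌋}` is the set of vertices outside `C` with exactly `⌊c/2⌋`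
neighbors on `C`. -/
theorem stmt5 {V : Type*} [Fintype V] (G : SimpleGraph V) (hG2 : TwoConnected G)
    (v : V) (w : G.Walk v v) (hw : w.IsCycle) (c : ℕ) (hlen : w.length = c)
    (hlongest : ∀ (x : V) (w' : G.Walk x x), w'.IsCycle → w'.length ≤ c)
    (hc4 : 4 ≤ c) (hcn : c + 1 ≤ Fintype.card V) :
    ((edgesOutside G {x | x ∈ w.support} + edgesCross G {x | x ∈ w.support} : ℕ) : ℝ)
      ≤ (↑(c / 2) : ℝ)
          * (↑({u | u ∉ w.support ∧ degOn G {x | x ∈ w.support} u = c / 2}.ncard) : ℝ)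
        + ((↑(c / 2) : ℝ) - 1 / 2)
          * ((Fintype.card V : ℝ) - (c : ℝ)
            - (↑({u | u ∉ w.support ∧ degOn G {x | x ∈ w.support} u = c / 2}.ncard) : ℝ)) := by
  classical
  subst hlen
  obtain ⟨f, hf, hr⟩ := exists_cy w hw
  obtain ⟨-, -, h2c⟩ := hG2
  have hconn : ∀ z a b : V, a ≠ z → b ≠ z → Rc G ({z}ᶜ) a b := by
    intro z a b ha hb
    obtain ⟨p⟩ := (h2c z).preconnected ⟨a, ha⟩ ⟨b, hb⟩
    exact rc_of_walk p
  have : Fact (1 < w.length) := ⟨by omega⟩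
  have h01 : f 0 ≠ f 1 := fun h => zero_ne_one (hf.inj h)
  have S1 : ∀ z ∉ Set.range f, ∀ a ∉ Set.range f, a ≠ z →
      ∃ b ∈ {b | ∃ y ∈ Set.range f, G.Adj b y}, Rc G ((Set.range f)ᶜ \ {z}) a b := by
    intro z hz a ha haz
    obtain ⟨b, hb, y, hy, -, hby⟩ := (hconn z a (f 0) haz (by rintro rfl; exact hz ⟨0, rfl⟩)).exit
      (C := Set.range f) ha ⟨0, rfl⟩
    exact ⟨b, ⟨y, hy, hby⟩, hb.mono fun x hx => ⟨hx.2, hx.1⟩⟩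
  have S2 : ∀ x ∈ Set.range f, ∀ a ∉ Set.range f,
      ∃ b ∈ {b | ∃ y ∈ Set.range f, y ≠ x ∧ G.Adj b y}, Rc G (Set.range f)ᶜ a b := by
    intro x hx a ha
    obtain ⟨t, ht, htx⟩ : ∃ t ∈ Set.range f, t ≠ x := by
      by_cases h0 : f 0 = x
      · exact ⟨f 1, ⟨1, rfl⟩, by rw [← h0]; exact h01.symm⟩
      · exact ⟨f 0, ⟨0, rfl⟩, h0⟩
    obtain ⟨b, hb, y, hy, hyx, hby⟩ := (hconn x a t (by rintro rfl; exact ha hx) htx).exit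
      (C := Set.range f) ha ht
    exact ⟨b, ⟨y, hy, hyx, hby⟩, hb.mono fun x hx => hx.2⟩
  have key := total_bound hf hc4 hlongest S1 S2 _ (Set.range f)ᶜ le_rfl subset_rfl
    (fun x _ y hy _ => hy)
  have hA : cn ({u | dc G (Set.range f) u = w.length / 2} ∩ (Set.range f)ᶜ) =
      {u | u ∉ w.support ∧ degOn G {x | x ∈ w.support} u = w.length / 2}.ncard := by
    rw [cn_eq_ncard]
    congr 1
    ext u
    rw [hr]
    simp [degOn_eq, and_comm]
  have hn : cn (Set.range f)ᶜ + w.length = Fintype.card V := by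
    rw [cn_eq_ncard]
    have h1 := Set.ncard_add_ncard_compl (Set.range f)
    have h2 : (Set.range f).ncard = w.length := by
      rw [← Set.image_univ, Set.ncard_image_of_injective _ hf.inj, Set.ncard_univ, Nat.card_zmod]
    rw [h2, Nat.card_eq_fintype_card] at h1
    omega
  rw [hA, ← edgesOutside_eq] at key
  have hx := edgesCross_le (G := G) (Set.range f)
  rw [← hr]
  rw [← hr] at key
  generalize {u | u ∉ w.support ∧ degOn G (Set.range f) u = w.length / 2}.ncard = A at *
  generalize cn (Set.range f)ᶜ = M at *
  generalize xc G (Set.range f) (Set.range f)ᶜ = X at *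
  generalize edgesOutside G (Set.range f) = e1 at *
  generalize edgesCross G (Set.range f) = e2 at *
  rw [← hn]
  generalize w.length / 2 = k at *
  have key' : 2 * e1 + 2 * e2 + M ≤ 2 * k * M + A := by omega
  have key'' : (2 * e1 + 2 * e2 + M : ℝ) ≤ 2 * k * M + A := by exact_mod_cast key'
  push_cast
  nlinarith
end

section
/- Let F be a graph and let G be an F-free graph on n vertices. Let C be a longest cycle of G of length c, where c is odd, 5 ≤ c ≤ n−1, p(F) ≥ ⌊c/2⌋ + 1, and |A_{⌊c/2⌋}| ≥ c·|V(F)|. If every graph in EX(⌊c/2⌋, 𝓗) contains some member of 𝓗' = {F − {u,v} : uv ∈ E(F)} as a subgraph, then the strict inequality e(G[C]) < ex(⌊c/2⌋, 𝓗) + ⌊c/2⌋·⌈c/2⌉ + 1 holds, where 𝓗 = {F[S] : S is a vertex covering of F}. -/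
open SimpleGraph

/-- cyclic parametrisation -/
structure CycParam {V : Type*} (G : SimpleGraph V) (c : ℕ) (f : ℤ → V) : Prop where
  per : ∀ i, f (i + c) = f i
  inj : ∀ i j, f i = f j → |i - j| < c → i = j
  adj : ∀ i, G.Adj (f i) (f (i + 1))

lemma CycParam.shift {V : Type*} {G : SimpleGraph V} {c : ℕ} {f : ℤ → V} (h : CycParam G c f)
    (r : ℤ) : CycParam G c (fun n => f (r + n)) where
  per i := by simpa [add_assoc] using h.per (r + i)
  inj i j hij hlt := by
    have := h.inj (r + i) (r + j) hij (by simpa using hlt)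
    omega
  adj i := by simpa [add_assoc] using h.adj (r + i)

lemma CycParam.neg {V : Type*} {G : SimpleGraph V} {c : ℕ} {f : ℤ → V} (h : CycParam G c f) :
    CycParam G c (fun n => f (- n)) where
  per i := by
    have := h.per (- (i + c))
    rw [← this]; congr 1; ring
  inj i j hij hlt := by
    have := h.inj (-i) (-j) hij (by rw [abs_lt] at *; omega)
    omega
  adj i := by
    have := h.adj (- (i + 1))
    rw [show -(i + 1) + 1 = -i by ring] at this
    exact this.symm

lemma exists_path_of_fun {V : Type*} {G : SimpleGraph V} (h : ℕ → V) (n : ℕ)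
    (hinj : ∀ a b, a ≤ n → b ≤ n → h a = h b → a = b)
    (hadj : ∀ a, a < n → G.Adj (h a) (h (a + 1))) :
    ∃ p : G.Walk (h 0) (h n), p.IsPath ∧ p.length = n ∧ ∀ x ∈ p.support, ∃ a ≤ n, x = h a := by
  induction n with
  | zero => exact ⟨Walk.nil, by simp, by simp, by simp⟩
  | succ n ih =>
    obtain ⟨p, hp, hl, hs⟩ := ih (fun a b ha hb => hinj a b (by omega) (by omega))
      (fun a ha => hadj a (by omega))
    refine ⟨p.concat (hadj n (by omega)), ?_, by simp [hl], ?_⟩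
    · apply hp.concat
      intro hmem
      obtain ⟨a, ha, hx⟩ := hs _ hmem
      have := hinj _ _ le_rfl (by omega) hx
      omega
    · intro x hx
      rw [Walk.support_concat] at hx
      simp only [List.mem_append, List.mem_singleton, List.concat_eq_append] at hx
      rcases hx with hx | hx
      · obtain ⟨a, ha, hx⟩ := hs _ hx
        exact ⟨a, by omega, hx⟩
      · exact ⟨n + 1, le_rfl, hx⟩

lemma exists_cycle_of_fun {V : Type*} {G : SimpleGraph V} (h : ℕ → V) (n : ℕ) (hn : 2 ≤ n)
    (hinj : ∀ a b, a ≤ n → b ≤ n → h a = h b → a = b)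
    (hadj : ∀ a, a < n → G.Adj (h a) (h (a + 1)))
    (hclose : G.Adj (h n) (h 0)) :
    ∃ (x : V) (w : G.Walk x x), w.IsCycle ∧ w.length = n + 1 := by
  obtain ⟨p, hp, hl, hs⟩ := exists_path_of_fun (fun a => h (a + 1)) (n - 1)
    (fun a b ha hb hab => by have := hinj (a + 1) (b + 1) (by omega) (by omega) hab; omega)
    (fun a ha => hadj (a + 1) (by omega))
  have hn1 : n - 1 + 1 = n := by omega
  have hclose' : G.Adj (h (n - 1 + 1)) (h 0) := by rw [hn1]; exact hclose
  have hq : (p.concat hclose').IsPath := by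
    apply hp.concat
    intro hmem
    obtain ⟨a, ha, hx⟩ := hs _ hmem
    have := hinj _ _ (by omega) (by omega) hx
    omega
  refine ⟨h 0, Walk.cons (hadj 0 (by omega)) (p.concat hclose'), ?_, by simp [hl]; omega⟩
  rw [Walk.cons_isCycle_iff]
  refine ⟨hq, ?_⟩
  intro hmem
  rw [Walk.edges_concat] at hmem
  simp only [List.concat_eq_append, List.mem_append, List.mem_singleton] at hmem
  rcases hmem with hmem | hmem
  · have := Walk.fst_mem_support_of_mem_edges p hmem
    obtain ⟨a, ha, hx⟩ := hs _ this
    have := hinj _ _ (by omega) (by omega) hx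
    omega
  · rw [Sym2.eq_iff] at hmem
    rcases hmem with ⟨h1, -⟩ | ⟨-, h1⟩
    · have := hinj _ _ (by omega) (by omega) h1; omega
    · have := hinj _ _ (by omega) (by omega) h1; omega

section
variable {V : Type*} {G : SimpleGraph V} {c : ℕ} {f : ℤ → V}

lemma CycParam.not_consec (h : CycParam G c f) (hc : 3 ≤ c)
    (hlong : ∀ (x : V) (w' : G.Walk x x), w'.IsCycle → w'.length ≤ c)
    (u : V) (hu : ∀ i, f i ≠ u) (i : ℤ) (h1 : G.Adj u (f i)) (h2 : G.Adj u (f (i + 1))) : False := by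
  obtain ⟨x, w, hw, hl⟩ := exists_cycle_of_fun (G := G) (fun n => if n = 0 then u else f (i + n)) c
    (by omega)
    (by
      intro a b ha hb hab
      try dsimp only at hab
      split_ifs at hab with h3 h4 h4
      · omega
      · exact absurd hab.symm (hu _)
      · exact absurd hab (hu _)
      · have := h.inj _ _ hab (by rw [abs_lt]; omega)
        omega)
    (by
      intro a ha
      try dsimp only
      rw [if_neg (by omega : a + 1 ≠ 0)]
      split_ifs with h3
      · subst h3; simpa using h2
      · have := h.adj (i + a)
        push_cast
        rwa [← add_assoc])
    (by
      simp only [if_true]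
      rw [if_neg (by omega), h.per]
      exact h1.symm)
  have := hlong x w hw
  omega

lemma CycParam.not_adj_succ (h : CycParam G c f) (hc : 3 ≤ c)
    (hlong : ∀ (x : V) (w' : G.Walk x x), w'.IsCycle → w'.length ≤ c)
    (u : V) (hu : ∀ i, f i ≠ u) (i : ℤ) (t : ℕ) (ht : 1 ≤ t) (htc : t < c)
    (h1 : G.Adj u (f i)) (h2 : G.Adj u (f (i + t)))
    (h3 : G.Adj (f (i + 1)) (f (i + t + 1))) : False := by
  obtain ⟨x, w, hw, hl⟩ := exists_cycle_of_fun (G := G)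
    (fun n => if n = 0 then u else if n ≤ t then f (i + (t + 1 - n)) else f (i + n)) c
    (by omega)
    (by
      intro a b ha hb hab
      try dsimp only at hab
      split_ifs at hab
      all_goals first
        | omega
        | exact absurd hab.symm (hu _)
        | exact absurd hab (hu _)
        | (have := h.inj _ _ hab (by rw [abs_lt]; omega)
           omega))
    (by
      intro a ha
      try dsimp only
      rw [if_neg (by omega : a + 1 ≠ 0)]
      by_cases h4 : a = 0
      · subst h4; rw [if_pos rfl, if_pos (by omega)]; simpa using h2
      rw [if_neg h4]
      by_cases h5 : a + 1 ≤ t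
      · rw [if_pos h5, if_pos (by omega)]
        have := (h.adj (i + (t + 1 - ((a + 1 : ℕ) : ℤ)))).symm
        convert this using 2
        push_cast; ring
      by_cases h6 : a = t
      · subst h6
        rw [if_pos le_rfl, if_neg (by omega)]
        convert h3 using 2
        · ring
        · push_cast; ring
      · rw [if_neg h5, if_neg (by omega)]
        have := h.adj (i + a)
        push_cast
        rwa [← add_assoc])
    (by
      simp only [if_true]
      rw [if_neg (by omega), if_neg (by omega), h.per]
      exact h1.symm)
  have := hlong x w hw
  omega

/-- gap structure of the neighbourhood -/
lemma CycParam.exists_gap (h : CycParam G c f) {k : ℕ} (hck : c = 2 * k + 1) (hk : 2 ≤ k)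
    (hlong : ∀ (x : V) (w' : G.Walk x x), w'.IsCycle → w'.length ≤ c)
    (u : V) (hu : ∀ i, f i ≠ u) (hdeg : {x | x ∈ Set.range f ∧ G.Adj u x}.ncard = k) :
    ∃ i0 : ℤ, ∀ j : ℕ, j < k → G.Adj u (f (i0 + (2 * j + 1))) := by
  have hnc := h.not_consec (by omega) hlong u hu
  obtain ⟨i0, hi0, hi1⟩ : ∃ i0, ¬ G.Adj u (f (i0 - 1)) ∧ ¬ G.Adj u (f i0) := by
    by_contra! hcon
    have key : ∀ i, G.Adj u (f (i + 1)) ↔ ¬ G.Adj u (f i) := by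
      intro i
      constructor
      · intro h1 h2; exact hnc i h2 h1
      · intro h1; exact hcon (i + 1) (by simpa using h1)
    have key2 : ∀ n : ℕ, G.Adj u (f (0 + 2 * n)) ↔ G.Adj u (f 0) := by
      intro n
      induction n with
      | zero => simp
      | succ n ih =>
        rw [← ih, show (0 + 2 * ((n + 1 : ℕ) : ℤ)) = 0 + 2 * n + 1 + 1 by push_cast; ring, key, key]
        simp
    have h1 := key (0 + 2 * k)
    rw [show (0 + 2 * (k : ℤ) + 1) = 0 + (c : ℤ) by rw [hck]; push_cast; ring, h.per, key2] at h1
    tauto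
  refine ⟨i0, ?_⟩
  have hlast : ¬ G.Adj u (f (i0 + 2 * k)) := by
    rwa [show i0 + 2 * (k : ℤ) = i0 - 1 + c by rw [hck]; push_cast; ring, h.per]
  -- representation of neighbours
  have hrep : ∀ x, x ∈ Set.range f → G.Adj u x → ∃ j : ℕ, j < k ∧
      (x = f (i0 + (2 * j + 1)) ∨ x = f (i0 + (2 * j + 2))) := by
    rintro x ⟨i, rfl⟩ hx
    have hmod : ∀ n : ℤ, ∀ i, f (i + n * c) = f i := by
      intro n
      induction n using Int.induction_on with
      | zero => simp
      | succ n ih => intro i; rw [add_mul, one_mul, ← add_assoc, h.per, ih]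
      | pred n ih => intro i; rw [← h.per, ← ih i]; congr 1; ring
    have h1 := Int.emod_nonneg (i - i0) (b := (c : ℤ)) (by omega)
    have h2 := Int.emod_lt_of_pos (i - i0) (b := (c : ℤ)) (by omega)
    have h3 := Int.emod_add_mul_ediv (i - i0) c
    obtain ⟨m, hm⟩ := Int.eq_ofNat_of_zero_le h1
    have hfi : f i = f (i0 + m) := by
      rw [← hmod ((i - i0) / c) (i0 + m), ← hm]
      congr 1
      linarith
    rw [hfi] at hx ⊢
    rw [hm] at h2
    have hm0 : m ≠ 0 := by rintro rfl; simp at hx; exact hi1 hx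
    rcases Nat.even_or_odd' m with ⟨j, hj | hj⟩
    · refine ⟨j - 1, by omega, Or.inr ?_⟩
      congr 1; omega
    · refine ⟨j, by omega, Or.inl ?_⟩
      congr 1; omega
  have hpair : ∀ j : ℕ, j < k →
      G.Adj u (f (i0 + (2 * j + 1))) ∨ G.Adj u (f (i0 + (2 * j + 2))) := by
    by_contra! hcon
    obtain ⟨j0, hj0, hn1, hn2⟩ := hcon
    choose! φ hφ1 hφ2 using hrep
    have hle : {x | x ∈ Set.range f ∧ G.Adj u x}.ncard ≤
        (((Finset.range k).erase j0 : Finset ℕ) : Set ℕ).ncard := by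
      apply Set.ncard_le_ncard_of_injOn φ
      · rintro x ⟨hx, hux⟩
        simp only [Finset.coe_erase, Finset.coe_range, Set.mem_sdiff, Set.mem_Iio,
          Set.mem_singleton_iff]
        refine ⟨hφ1 x hx hux, ?_⟩
        intro he
        have := hφ2 x hx hux
        rw [he] at this
        rcases this with h' | h'
        · rw [h'] at hux; exact hn1 hux
        · rw [h'] at hux; exact hn2 hux
      · rintro x ⟨hx, hux⟩ y ⟨hy, huy⟩ hxy
        have h1 := hφ2 x hx hux
        have h2 := hφ2 y hy huy
        rw [← hxy] at h2
        have h3 := hnc (i0 + (2 * φ x + 1))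
        rw [show i0 + (2 * (φ x : ℤ) + 1) + 1 = i0 + (2 * φ x + 2) by ring] at h3
        rcases h1 with h1 | h1 <;> rcases h2 with h2 | h2
        · rw [h1, h2]
        · exact (h3 (h1 ▸ hux) (h2 ▸ huy)).elim
        · exact (h3 (h2 ▸ huy) (h1 ▸ hux)).elim
        · rw [h1, h2]
    rw [hdeg, Set.ncard_coe_finset, Finset.card_erase_of_mem (by simpa using hj0),
      Finset.card_range] at hle
    omega
  have hdown : ∀ n : ℕ, n < k → G.Adj u (f (i0 + (2 * ((k - 1 - n : ℕ) : ℤ) + 1))) := by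
    intro n
    induction n with
    | zero =>
      intro _
      rcases hpair (k - 1 - 0) (by omega) with h' | h'
      · exact h'
      · exfalso; apply hlast
        convert h' using 2
        try omega
    | succ n ih =>
      intro hn
      have h1 := ih (by omega)
      rcases hpair (k - 1 - (n + 1)) (by omega) with h' | h'
      · exact h'
      · exfalso
        apply hnc _ h'
        convert h1 using 2
        omega
  intro j hj
  have := hdown (k - 1 - j) (by omega)
  rwa [show k - 1 - (k - 1 - j) = j by omega] at this

end

lemma exists_cycParam {V : Type*} {G : SimpleGraph V} {v : V} (w : G.Walk v v) (hw : w.IsCycle) :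
    ∃ f : ℤ → V, CycParam G w.length f ∧ Set.range f = {x | x ∈ w.support} := by
  have hc := hw.three_le_length
  set c := w.length with hcdef
  have hnn : ∀ i : ℤ, 0 ≤ i % c := fun i => Int.emod_nonneg _ (by omega)
  have hlt : ∀ i : ℤ, i % c < c := fun i => Int.emod_lt_of_pos _ (by omega)
  refine ⟨fun i => w.getVert (i % c).toNat, ⟨?_, ?_, ?_⟩, ?_⟩
  · intro i; simp
  · intro i j hij habs
    have h1 := hw.getVert_injOn' (by have := hnn i; have := hlt i; simp; omega)
      (by have := hnn j; have := hlt j; simp; omega) hij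
    have h2 : i % c = j % c := by have := hnn i; have := hnn j; omega
    have h3 : (c : ℤ) ∣ i - j := Int.ModEq.dvd (show j ≡ i [ZMOD c] from h2.symm)
    have := Int.eq_zero_of_abs_lt_dvd h3 habs
    omega
  · intro i
    have h1 := hnn i
    have h2 := hlt i
    have h3 := w.adj_getVert_succ (i := (i % c).toNat) (by omega)
    by_cases h4 : i % c + 1 < c
    · have : (i + 1) % c = i % c + 1 := by
        rw [← Int.emod_add_emod]; exact Int.emod_eq_of_lt (by omega) h4
      try dsimp only
      rw [this]
      convert h3 using 2
      omega
    · have : (i + 1) % c = 0 := by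
        rw [← Int.emod_add_emod, show i % c + 1 = (c : ℤ) by omega]; simp
      try dsimp only
      rw [this]
      rw [show (i % c).toNat + 1 = w.length by omega, w.getVert_length] at h3
      simpa using h3
  · ext x
    simp only [Set.mem_range, Set.mem_ofPred_eq]
    constructor
    · rintro ⟨i, rfl⟩; exact w.getVert_mem_support _
    · intro hx
      obtain ⟨n, rfl, hn⟩ := Walk.mem_support_iff_exists_getVert.1 hx
      rcases Nat.lt_or_ge n c with h | h
      · refine ⟨n, ?_⟩
        rw [Int.emod_eq_of_lt (by omega) (by omega)]; simp
      · refine ⟨0, ?_⟩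
        rw [show n = w.length by omega]; simp

/-- Strict version of the odd-cycle edge bound: if moreover `c ≥ 5` and every
graph in `EX(⌊c/2⌋, 𝓗)` contains a member of `𝓗' = {F − {u,v} : uv ∈ E(F)}`,
then `e(G[C]) < ex(⌊c/2⌋, 𝓗) + ⌊c/2⌋·⌈c/2⌉ + 1`. -/
theorem stmt9 {V α : Type*} [Fintype V] [Fintype α] (F : SimpleGraph α)
    (G : SimpleGraph V) (hGF : ¬ ContainsCopy F G)
    (v : V) (w : G.Walk v v) (hw : w.IsCycle) (c : ℕ) (hlen : w.length = c)
    (hlongest : ∀ (x : V) (w' : G.Walk x x), w'.IsCycle → w'.length ≤ c)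
    (hcodd : Odd c) (hc5 : 5 ≤ c) (hcn : c + 1 ≤ Fintype.card V)
    (hpF : PGE F (c / 2 + 1))
    (hA : c * Fintype.card α
      ≤ {u | u ∉ w.support ∧ degOn G {x | x ∈ w.support} u = c / 2}.ncard)
    (hEX : ∀ T : SimpleGraph (Fin (c / 2)), CoverFree F T →
      edgeCount T = exMax (c / 2) (CoverFree F) →
      ∃ u v', F.Adj u v' ∧ ContainsCopy (F.induce ({u, v'}ᶜ : Set α)) T) :
    edgesWithin G {x | x ∈ w.support}
      < exMax (c / 2) (CoverFree F) + (c / 2) * ((c + 1) / 2) + 1 := by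
  classical
  obtain ⟨k, hk⟩ := hcodd
  have hk2 : 2 ≤ k := by omega
  have hc2 : c / 2 = k := by omega
  have hc3 : (c + 1) / 2 = k + 1 := by omega
  rw [hc2] at hA hEX
  rw [hc2, hc3]
  obtain ⟨f, hf, hrange⟩ := exists_cycParam w hw
  rw [hlen] at hf
  rw [← hrange] at hA ⊢
  have hFne : 0 < Fintype.card α := by
    by_contra hcon
    have : IsEmpty α := Fintype.card_eq_zero_iff.1 (by omega)
    exact hGF ⟨fun a => isEmptyElim a, fun a => isEmptyElim a, fun a => isEmptyElim a⟩
  have hsupp : ∀ x, x ∈ w.support ↔ x ∈ Set.range f := by intro x; rw [hrange]; rfl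
  -- the set of vertices with k neighbours
  set A : Finset V := Finset.univ.filter
    (fun u => u ∉ Set.range f ∧ degOn G (Set.range f) u = k) with hAdef
  have hAcard : c * Fintype.card α ≤ A.card := by
    rw [← Set.ncard_coe_finset]
    refine hA.trans (le_of_eq ?_)
    congr 1
    ext u
    simp [hAdef, hsupp]
  have hmod : ∀ n : ℤ, ∀ i, f (i + n * c) = f i := by
    intro n
    induction n using Int.induction_on with
    | zero => simp
    | succ n ih => intro i; rw [add_mul, one_mul, ← add_assoc, hf.per, ih]
    | pred n ih => intro i; rw [← hf.per, ← ih i]; congr 1; ring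
  have hgap : ∀ u, u ∈ A → ∃ r ∈ Finset.range c, ∀ j : ℕ, j < k →
      G.Adj u (f (r + (2 * j + 1))) := by
    intro u hu
    simp only [hAdef, Finset.mem_filter, Finset.mem_univ, true_and] at hu
    obtain ⟨i0, hi0⟩ := hf.exists_gap hk hk2 hlongest u (fun i hi => hu.1 ⟨i, hi⟩) hu.2
    have h1 := Int.emod_nonneg i0 (b := (c : ℤ)) (by omega)
    have h2 := Int.emod_lt_of_pos i0 (b := (c : ℤ)) (by omega)
    have h3 := Int.emod_add_mul_ediv i0 c
    refine ⟨(i0 % c).toNat, by simp; omega, fun j hj => ?_⟩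
    have := hi0 j hj
    rw [← hmod (i0 / c), Int.toNat_of_nonneg h1]
    convert this using 2
    linarith
  choose! ρ hρ1 hρ2 using hgap
  obtain ⟨r, hr, hBcard⟩ := Finset.exists_le_card_fiber_of_mul_le_card_of_maps_to
    (s := A) (t := Finset.range c) (f := ρ) hρ1 ⟨0, by simp; omega⟩
    (n := Fintype.card α) (by simpa using hAcard)
  set B : Finset V := A.filter (fun u => ρ u = r) with hB
  set g : ℤ → V := fun n => f (r + n) with hg
  have hgc : CycParam G c g := hf.shift r
  have hgrange : ∀ n, g n ∈ Set.range f := fun n => ⟨_, rfl⟩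
  have hBadj : ∀ u ∈ B, ∀ j : ℕ, j < k → G.Adj u (g (2 * j + 1)) := by
    intro u hu j hj
    rw [hB, Finset.mem_filter] at hu
    have := hρ2 u hu.1 j hj
    rwa [hu.2] at this
  have hBout : ∀ u ∈ B, ∀ i, g i ≠ u := by
    intro u hu i hi
    rw [hB, Finset.mem_filter, hAdef, Finset.mem_filter] at hu
    exact hu.1.2.1 (hi ▸ hgrange i)
  obtain ⟨u0, hu0⟩ : B.Nonempty := Finset.card_pos.1 (by omega)
  -- the two sides
  let X : Fin k → V := fun j => g (2 * (j : ℕ) + 1)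
  let Y : Fin (k + 1) → V := fun j => g (2 * (j : ℕ))
  have hXinj : Function.Injective X := by
    intro a b hab
    have := hgc.inj _ _ hab (by rw [abs_lt]; omega)
    ext; omega
  have hXY : ∀ a b, X a ≠ Y b := by
    intro a b hab
    have := hgc.inj _ _ hab (by rw [abs_lt]; omega)
    omega
  have hcover : ∀ x ∈ Set.range f, (∃ a, x = X a) ∨ (∃ b, x = Y b) := by
    rintro x ⟨i, rfl⟩
    have h1 := Int.emod_nonneg (i - r) (b := (c : ℤ)) (by omega)
    have h2 := Int.emod_lt_of_pos (i - r) (b := (c : ℤ)) (by omega)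
    have h3 := Int.emod_add_mul_ediv (i - r) c
    obtain ⟨m, hm⟩ := Int.eq_ofNat_of_zero_le h1
    have hfi : f i = g m := by
      rw [hg]
      try dsimp only
      rw [← hmod ((i - r) / c) (r + m), ← hm]
      congr 1
      linarith
    rw [hm] at h2
    rw [hfi]
    rcases Nat.even_or_odd' m with ⟨j, hj | hj⟩
    · exact Or.inr ⟨⟨j, by omega⟩, by simp [Y, hj]⟩
    · exact Or.inl ⟨⟨j, by omega⟩, by simp [X, hj]⟩
  have hYlt : ∀ a b : ℕ, a < b → b ≤ k → ¬ (a = 0 ∧ b = k) →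
      ¬ G.Adj (g (2 * a)) (g (2 * b)) := by
    intro a b hab hbk hne hadj
    by_cases ha : a = 0
    · -- predecessors
      have hb : b < k := by omega
      have hn := hgc.neg
      refine hn.not_adj_succ (by omega) hlongest u0 (fun i => hBout u0 hu0 _) (-(2 * b + 1))
        (2 * (b - a)) (by omega) (by omega) ?_ ?_ ?_
      · convert hBadj u0 hu0 b hb using 2
        ring
      · convert hBadj u0 hu0 a (by omega) using 2
        omega
      · convert hadj.symm using 2
        · ring
        · omega
    · refine hgc.not_adj_succ (by omega) hlongest u0 (hBout u0 hu0) (2 * ((a - 1 : ℕ) : ℤ) + 1)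
        (2 * (b - a)) (by omega) (by omega) ?_ ?_ ?_
      · exact hBadj u0 hu0 (a - 1) (by omega)
      · convert hBadj u0 hu0 (b - 1) (by omega) using 2
        omega
      · convert hadj using 2
        · omega
        · omega
  let T : SimpleGraph (Fin k) := G.comap X
  have hTfree : CoverFree F T := by
    rintro S hS ⟨φ, hφ, hφadj⟩
    obtain ⟨ψ⟩ : Nonempty (α ↪ B) := Function.Embedding.nonempty_of_card_le (by simpa using hBcard)
    refine hGF ⟨fun a => if h : a ∈ S then X (φ ⟨a, h⟩) else ψ a, ?_, ?_⟩
    · intro a b hab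
      try dsimp only at hab
      split_ifs at hab with h1 h2 h2
      · simpa using hφ (hXinj hab)
      · exact (hBout _ (ψ b).2 _ hab).elim
      · exact (hBout _ (ψ a).2 _ hab.symm).elim
      · exact ψ.injective (Subtype.ext hab)
    · intro a b hab
      try dsimp only
      split_ifs with h1 h2 h2
      · exact hφadj (a := ⟨a, h1⟩) (b := ⟨b, h2⟩) hab
      · exact (hBadj _ (ψ b).2 _ (φ ⟨a, h1⟩).2).symm
      · exact hBadj _ (ψ a).2 _ (φ ⟨b, h2⟩).2
      · exact (hS a b h1 h2 hab).elim
  have hTle : edgeCount T ≤ exMax k (CoverFree F) := by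
    apply le_csSup
    · have : {m | ∃ G : SimpleGraph (Fin k), CoverFree F G ∧ edgeCount G = m} ⊆
          Set.range (fun G : SimpleGraph (Fin k) => edgeCount G) := by
        rintro m ⟨G, -, h⟩; exact ⟨G, h⟩
      exact ((Set.finite_range _).subset this).bddAbove
    · exact ⟨T, hTfree, rfl⟩
  -- counting
  let D : Set (Fin k × Fin (k + 1)) := {p | G.Adj (X p.1) (Y p.2)}
  let Z : Set (Sym2 V) := {e | e = s(g (2 * (0 : ℕ)), g (2 * k)) ∧ G.Adj (g (2 * (0 : ℕ))) (g (2 * k))}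
  have hsub : {e ∈ G.edgeSet | ∀ x ∈ e, x ∈ Set.range f} ⊆
      (Sym2.map X '' T.edgeSet) ∪ ((fun p : Fin k × Fin (k + 1) => s(X p.1, Y p.2)) '' D) ∪ Z := by
    rintro e ⟨he, hmem⟩
    induction e using Sym2.ind with
    | _ x y =>
    rw [mem_edgeSet] at he
    rcases hcover x (hmem x (by simp)) with ⟨a, rfl⟩ | ⟨a, rfl⟩ <;>
    rcases hcover y (hmem y (by simp)) with ⟨b, rfl⟩ | ⟨b, rfl⟩
    · exact Or.inl (Or.inl ⟨s(a, b), he, rfl⟩)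
    · exact Or.inl (Or.inr ⟨(a, b), he, rfl⟩)
    · exact Or.inl (Or.inr ⟨(b, a), he.symm, Sym2.eq_swap⟩)
    · right
      rcases lt_trichotomy (a : ℕ) (b : ℕ) with hab | hab | hab
      · by_cases hh : (a : ℕ) = 0 ∧ (b : ℕ) = k
        · simp only [Y, hh.1, hh.2] at he ⊢
          exact ⟨rfl, he⟩
        · exact (hYlt a b hab (by omega) hh he).elim
      · exact (he.ne (by simp [Y, hab])).elim
      · by_cases hh : (b : ℕ) = 0 ∧ (a : ℕ) = k
        · simp only [Y, hh.1, hh.2] at he ⊢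
          exact ⟨Sym2.eq_swap, he.symm⟩
        · exact (hYlt b a hab (by omega) hh he.symm).elim
  have hcount : edgesWithin G (Set.range f) ≤ edgeCount T + D.ncard + Z.ncard := by
    unfold edgesWithin edgeCount
    refine (Set.ncard_le_ncard hsub (Set.toFinite _)).trans ?_
    refine (Set.ncard_union_le _ _).trans ?_
    gcongr
    refine (Set.ncard_union_le _ _).trans ?_
    gcongr
    · exact Set.ncard_image_le (Set.toFinite _)
    · exact Set.ncard_image_le (Set.toFinite _)
  have hDle : D.ncard ≤ k * (k + 1) := by
    have := Set.ncard_le_ncard (Set.subset_univ D) (Set.toFinite _)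
    simpa [Set.ncard_univ] using this
  have hZsub : Z ⊆ {s(g (2 * (0 : ℕ)), g (2 * k))} := fun e he => he.1
  have hZle : Z.ncard ≤ 1 := by
    simpa using Set.ncard_le_ncard hZsub (Set.toFinite _)
  by_contra hcon
  have hTeq : edgeCount T = exMax k (CoverFree F) := by omega
  have hDeq : D = Set.univ := by
    apply Set.eq_of_subset_of_ncard_le (Set.subset_univ D) _ (Set.toFinite _)
    have : (Set.univ : Set (Fin k × Fin (k + 1))).ncard = k * (k + 1) := by simp [Set.ncard_univ]
    omega
  obtain ⟨e, -, hyy⟩ : Z.Nonempty := by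
    rw [← Set.ncard_pos (Set.toFinite _)]; omega
  have hXYadj : ∀ a b, G.Adj (X a) (Y b) := by
    intro a b
    have : (a, b) ∈ D := by rw [hDeq]; trivial
    exact this
  obtain ⟨p, q, hpq, φ, hφ, hφadj⟩ := hEX T hTfree hTeq
  let y0 : Fin (k + 1) := ⟨0, by omega⟩
  let y1 : Fin (k + 1) := ⟨k, by omega⟩
  have hy : G.Adj (Y y0) (Y y1) := hyy
  have hmemS : ∀ a, a ≠ p → a ≠ q → a ∈ ({p, q}ᶜ : Set α) := by
    intro a h1 h2; simp [h1, h2]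
  refine hGF ⟨fun a => if h1 : a = p then Y y0 else if h2 : a = q then Y y1 else
    X (φ ⟨a, hmemS a h1 h2⟩), ?_, ?_⟩
  · intro a b hab
    dsimp only at hab
    split_ifs at hab
    all_goals first
      | exact (hXY _ _ hab).elim
      | exact (hXY _ _ hab.symm).elim
      | exact (hy.ne hab).elim
      | exact (hy.ne hab.symm).elim
      | simpa using hφ (hXinj hab)
      | (subst_vars; rfl)
  · intro a b hab
    dsimp only
    split_ifs
    all_goals first
      | exact hXYadj _ _
      | exact (hXYadj _ _).symm
      | exact hy
      | exact hy.symm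
      | exact hφadj (a := ⟨a, hmemS a ‹_› ‹_›⟩) (b := ⟨b, hmemS b ‹_› ‹_›⟩) hab
      | (subst_vars; exact (hab.ne rfl).elim)
end
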